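/- Let A, B be N×N complex matrices with A invertible, let λ, μ be partitions with at most N parts, and let q ≥ 1 be an integer. Then ∫_{U(N)} s_λ(UA) s_μ(U† B) (det U)^q d_*U = δ_{μ, λ+q^N} · (s_μ(AB)/s_μ(I_N)) · (det A)^{−q}, i.e. the integral vanishes unless μ = λ + q^N, in which case it equals (det A)^{−q} s_μ(AB)/s_μ(I_N). -/

import Mathlib

open scoped BigOperators Classical
open MeasureTheory Matrix

noncomputable section

/-- Complete homogeneous symmetric functions of the eigenvalues of `X`, defined through
Newton's identities from the power sums `p_m = Tr(X^m)`. -/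
def hMat {N : ℕ} (X : Matrix (Fin N) (Fin N) ℂ) : ℕ → ℂ
  | 0 => 1
  | (k+1) => ((k : ℂ) + 1)⁻¹ *
      ∑ m ∈ Finset.range (k+1), (X ^ (m+1)).trace * hMat X (k - m)
  termination_by k => k
  decreasing_by exact Nat.lt_succ_of_le (Nat.sub_le _ _)

def hMatZ {N : ℕ} (X : Matrix (Fin N) (Fin N) ℂ) (k : ℤ) : ℂ :=
  if k < 0 then 0 else hMat X k.toNat

/-- The Schur polynomial `s_λ(X)` of an `N×N` complex matrix `X`, evaluated at the
eigenvalues of `X`, via the Jacobi-Trudi formula `s_λ = det(h_{λ_i - i + j})`.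
Here `l : Fin N → ℕ` lists the (at most `N`) parts of the partition `λ`. -/
def schur {N : ℕ} (l : Fin N → ℕ) (X : Matrix (Fin N) (Fin N) ℂ) : ℂ :=
  (Matrix.of fun i j : Fin N => hMatZ X ((l i : ℤ) - (i : ℤ) + (j : ℤ))).det

/-- Partitions with at most `N` parts (weakly decreasing functions `Fin N → ℕ`). -/
def PartitionN (N : ℕ) := {l : Fin N → ℕ // Antitone l}

/-- The unitary group `U(N)`. -/
abbrev UN (N : ℕ) := Matrix.unitaryGroup (Fin N) ℂ

instance (N : ℕ) : MeasurableSpace (UN N) := borel _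


namespace UnitarySchur

open MvPolynomial

section PolynomialFunctions

variable {X X' Y σ τ : Type*}

/-- Polynomial functions in a family of coordinate functions `c`. -/
def polyFun (c : σ → X → ℂ) : Subalgebra ℂ (X → ℂ) where
  carrier := {f | ∃ p : MvPolynomial σ ℂ, ∀ x, f x = eval (fun i => c i x) p}
  mul_mem' := by
    rintro f g ⟨p, hp⟩ ⟨q, hq⟩
    exact ⟨p * q, fun x => by simp [hp, hq]⟩
  add_mem' := by
    rintro f g ⟨p, hp⟩ ⟨q, hq⟩
    exact ⟨p + q, fun x => by simp [hp, hq]⟩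
  algebraMap_mem' a := ⟨MvPolynomial.C a, fun x => by simp⟩

lemma mem_polyFun_iff {c : σ → X → ℂ} {f : X → ℂ} :
    f ∈ polyFun c ↔ ∃ p : MvPolynomial σ ℂ, ∀ x, f x = eval (fun i => c i x) p := Iff.rfl

lemma coord_mem_polyFun (c : σ → X → ℂ) (i : σ) : c i ∈ polyFun c :=
  mem_polyFun_iff.2 ⟨MvPolynomial.X i, fun x => by simp⟩

lemma const_mem_polyFun (c : σ → X → ℂ) (a : ℂ) : (fun _ => a) ∈ polyFun c :=
  mem_polyFun_iff.2 ⟨MvPolynomial.C a, fun x => by simp⟩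

lemma polyFun_comp {c : σ → X → ℂ} {c' : τ → X' → ℂ} {f : X → ℂ} (hf : f ∈ polyFun c)
    {g : X' → X} (hg : ∀ i, (fun x' => c i (g x')) ∈ polyFun c') :
    (fun x' => f (g x')) ∈ polyFun c' := by
  obtain ⟨p, hp⟩ := mem_polyFun_iff.1 hf
  rw [show (fun x' => f (g x')) = fun x' => eval (fun i => c i (g x')) p from
    funext fun x' => hp _]
  clear hp hf
  induction p using MvPolynomial.induction_on with
  | C a => simpa using const_mem_polyFun c' a
  | add p q h1 h2 =>
    simp only [map_add]
    exact add_mem h1 h2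
  | mul_X p i h1 =>
    simp only [map_mul, eval_X]
    exact mul_mem h1 (hg i)

lemma polyFun_continuous [TopologicalSpace X] {c : σ → X → ℂ} (hc : ∀ i, Continuous (c i))
    {f : X → ℂ} (hf : f ∈ polyFun c) : Continuous f := by
  obtain ⟨p, hp⟩ := mem_polyFun_iff.1 hf
  rw [show f = fun x => eval (fun i => c i x) p from funext hp]
  clear hp hf
  induction p using MvPolynomial.induction_on with
  | C a => simpa using continuous_const
  | add p q h1 h2 =>
    simp only [map_add]
    exact h1.add h2
  | mul_X p i h1 =>
    simp only [map_mul, eval_X]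
    exact h1.mul (hc i)

/-- Evaluation at a point, as a ring homomorphism on continuous functions. -/
def contEval {Y : Type*} [TopologicalSpace Y] (y : Y) : C(Y, ℂ) →+* ℂ :=
  (Pi.evalRingHom (fun _ : Y => ℂ) y).comp ContinuousMap.coeFnRingHom

@[simp]
lemma contEval_apply {Y : Type*} [TopologicalSpace Y] (y : Y) (g : C(Y, ℂ)) :
    contEval y g = g y := rfl

/-- Functions of `y` and `x`, polynomial in the coordinates of `x` with coefficients continuous
in `y`. -/
def paramPoly (Y : Type*) [TopologicalSpace Y] (c : σ → X → ℂ) : Subring (Y → X → ℂ) where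
  carrier := {Φ | ∃ P : MvPolynomial σ C(Y, ℂ), ∀ y x,
    Φ y x = eval₂ (contEval y) (fun i => c i x) P}
  mul_mem' := by
    rintro f g ⟨p, hp⟩ ⟨q, hq⟩
    exact ⟨p * q, fun y x => by simp [hp, hq]⟩
  one_mem' := ⟨1, fun y x => by simp⟩
  add_mem' := by
    rintro f g ⟨p, hp⟩ ⟨q, hq⟩
    exact ⟨p + q, fun y x => by simp [hp, hq]⟩
  zero_mem' := ⟨0, fun y x => by simp⟩
  neg_mem' := by
    rintro f ⟨p, hp⟩
    refine ⟨MvPolynomial.C (-1) * p, fun y x => ?_⟩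
    rw [eval₂_mul, eval₂_C, map_neg, map_one, neg_one_mul, ← hp]
    rfl

variable [TopologicalSpace Y]

lemma mem_paramPoly_iff {c : σ → X → ℂ} {Φ : Y → X → ℂ} :
    Φ ∈ paramPoly Y c ↔ ∃ P : MvPolynomial σ C(Y, ℂ), ∀ y x,
      Φ y x = eval₂ (contEval y) (fun i => c i x) P := Iff.rfl

lemma param_mem_paramPoly (c : σ → X → ℂ) {g : Y → ℂ} (hg : Continuous g) :
    (fun y (_ : X) => g y) ∈ paramPoly Y c :=
  mem_paramPoly_iff.2 ⟨MvPolynomial.C ⟨g, hg⟩, fun y x => by simp⟩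

lemma polyFun_mem_paramPoly {c : σ → X → ℂ} {f : X → ℂ} (hf : f ∈ polyFun c) :
    (fun (_ : Y) x => f x) ∈ paramPoly Y c := by
  obtain ⟨p, hp⟩ := mem_polyFun_iff.1 hf
  refine mem_paramPoly_iff.2 ⟨p.map (algebraMap ℂ C(Y, ℂ)), fun y x => ?_⟩
  rw [hp, eval₂_map, eval, coe_eval₂Hom]
  rfl

lemma paramPoly_comp {c : σ → X → ℂ} {c' : τ → X' → ℂ} {f : X → ℂ} (hf : f ∈ polyFun c)
    {g : Y → X' → X} (hg : ∀ i, (fun y x' => c i (g y x')) ∈ paramPoly Y c') :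
    (fun y x' => f (g y x')) ∈ paramPoly Y c' := by
  obtain ⟨p, hp⟩ := mem_polyFun_iff.1 hf
  rw [show (fun y x' => f (g y x')) = fun y x' => eval (fun i => c i (g y x')) p from
    funext fun y => funext fun x' => hp _]
  clear hp hf
  induction p using MvPolynomial.induction_on with
  | C a => simpa using param_mem_paramPoly c' continuous_const
  | add p q h1 h2 => 
    simp only [map_add]
    exact add_mem h1 h2
  | mul_X p i h1 => 
    simp only [map_mul, eval_X]
    exact mul_mem h1 (hg i)

lemma integral_coeff_eval [CompactSpace Y] [MeasurableSpace Y] [BorelSpace Y] (ν : Measure Y)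
    [IsFiniteMeasure ν] {c : σ → X → ℂ} (P : MvPolynomial σ C(Y, ℂ)) (x : X) :
    ∫ y, eval₂ (contEval y) (fun i => c i x) P ∂ν =
      eval (fun i => c i x) (∑ d ∈ P.support, monomial d (∫ y, P.coeff d y ∂ν)) := by
  simp only [eval₂_eq]
  rw [integral_finsetSum]
  · simp only [map_sum, eval_monomial]
    refine Finset.sum_congr rfl fun d _ => ?_
    rw [integral_mul_const]
    rfl
  · intro d _
    refine Integrable.mul_const ?_ _
    exact (P.coeff d).continuous.integrable_of_hasCompactSupport
      (HasCompactSupport.of_compactSpace _)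

lemma integral_mem_polyFun [CompactSpace Y] [MeasurableSpace Y] [BorelSpace Y] (ν : Measure Y)
    [IsFiniteMeasure ν] {c : σ → X → ℂ} {Φ : Y → X → ℂ} (hΦ : Φ ∈ paramPoly Y c) :
    (fun x => ∫ y, Φ y x ∂ν) ∈ polyFun c := by
  obtain ⟨P, hP⟩ := mem_paramPoly_iff.1 hΦ
  refine mem_polyFun_iff.2 ⟨∑ d ∈ P.support, monomial d (∫ y, P.coeff d y ∂ν), fun x => ?_⟩
  simp only [hP]
  exact integral_coeff_eval ν P x

lemma integral_poly_support [CompactSpace Y] [MeasurableSpace Y] [BorelSpace Y] (ν : Measure Y)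
    [IsFiniteMeasure ν] {Φ : Y → (σ → ℂ) → ℂ} (hΦ : Φ ∈ paramPoly Y (fun i (x : σ → ℂ) => x i))
    (S : Set (σ →₀ ℕ))
    (hS : ∀ y, ∃ q : MvPolynomial σ ℂ, (∀ x, Φ y x = eval x q) ∧ ∀ d ∈ q.support, d ∈ S) :
    ∃ q : MvPolynomial σ ℂ, (∀ x, ∫ y, Φ y x ∂ν = eval x q) ∧ ∀ d ∈ q.support, d ∈ S := by
  obtain ⟨P, hP⟩ := mem_paramPoly_iff.1 hΦ
  refine ⟨∑ d ∈ P.support, monomial d (∫ y, P.coeff d y ∂ν), fun x => ?_, ?_⟩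
  · simp only [hP]
    exact integral_coeff_eval (c := fun i (x : σ → ℂ) => x i) ν P x
  · intro d hd
    by_contra hdS
    have hz : ∀ y, P.coeff d y = 0 := by
      intro y
      obtain ⟨q, hq, hqS⟩ := hS y
      have hqP : q = P.map (contEval y) := by
        refine MvPolynomial.funext fun x => ?_
        rw [← hq, hP, eval_map]
      have : q.coeff d = 0 := by
        by_contra h
        exact hdS (hqS d (MvPolynomial.mem_support_iff.2 h))
      rw [hqP, coeff_map] at this
      exact this
    refine MvPolynomial.mem_support_iff.1 hd ?_
    rw [coeff_sum]
    refine Finset.sum_eq_zero fun e _ => ?_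
    rw [coeff_monomial]
    split_ifs with h
    · subst h
      simp [hz]
    · rfl

end PolynomialFunctions

end UnitarySchur

namespace UnitarySchur

open MvPolynomial

/-- Complex `N × N` matrices. -/
abbrev Mat (N : ℕ) := Matrix (Fin N) (Fin N) ℂ

/-- The coordinate functions on matrices. -/
def entry {N : ℕ} (p : Fin N × Fin N) (A : Mat N) : ℂ := A p.1 p.2

section MatrixPolynomials

variable {N : ℕ} {X Y σ : Type*}

lemma polyFun_entry_mul {c : σ → X → ℂ} {g h : X → Mat N}
    (hg : ∀ p, (fun x => entry p (g x)) ∈ polyFun c)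
    (hh : ∀ p, (fun x => entry p (h x)) ∈ polyFun c) (p : Fin N × Fin N) :
    (fun x => entry p (g x * h x)) ∈ polyFun c := by
  have : (fun x => entry p (g x * h x)) =
      ∑ k, (fun x => entry (p.1, k) (g x)) * (fun x => entry (k, p.2) (h x)) := by
    funext x
    simp [entry, Matrix.mul_apply]
  rw [this]
  exact sum_mem fun k _ => mul_mem (hg _) (hh _)

lemma polyFun_det {n : Type*} [Fintype n] [DecidableEq n] {c : σ → X → ℂ}
    {g : X → Matrix n n ℂ} (hg : ∀ i j, (fun x => g x i j) ∈ polyFun c) :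
    (fun x => (g x).det) ∈ polyFun c := by
  have : (fun x => (g x).det) = ∑ s : Equiv.Perm n,
      (Equiv.Perm.sign s : ℤ) • ∏ i, fun x => g x (s i) i := by
    funext x
    simp [Matrix.det_apply, Units.smul_def]
  rw [this]
  exact sum_mem fun s _ => zsmul_mem (prod_mem fun i _ => hg _ _) _

lemma polyFun_entry_const (c : σ → X → ℂ) (A : Mat N) (p : Fin N × Fin N) :
    (fun _ : X => entry p A) ∈ polyFun c := const_mem_polyFun c _

lemma polyFun_entry_id (p : Fin N × Fin N) :
    (fun A : Mat N => entry p A) ∈ polyFun (entry (N := N)) := coord_mem_polyFun _ p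

lemma polyFun_entry_diagonal (p : Fin N × Fin N) :
    (fun x : Fin N → ℂ => entry p (diagonal x)) ∈ polyFun (fun i (x : Fin N → ℂ) => x i) := by
  by_cases h : p.1 = p.2
  · simpa [entry, h] using coord_mem_polyFun (fun i (x : Fin N → ℂ) => x i) p.2
  · simpa [entry, h] using const_mem_polyFun (fun i (x : Fin N → ℂ) => x i) 0

lemma entry_continuous (p : Fin N × Fin N) : Continuous (entry (N := N) p) :=
  continuous_id.matrix_elem _ _

lemma matPoly_continuous {f : Mat N → ℂ} (hf : f ∈ polyFun entry) : Continuous f :=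
  polyFun_continuous entry_continuous hf

variable [TopologicalSpace Y]

lemma paramPoly_entry_mul {c : σ → X → ℂ} {g h : Y → X → Mat N}
    (hg : ∀ p, (fun y x => entry p (g y x)) ∈ paramPoly Y c)
    (hh : ∀ p, (fun y x => entry p (h y x)) ∈ paramPoly Y c) (p : Fin N × Fin N) :
    (fun y x => entry p (g y x * h y x)) ∈ paramPoly Y c := by
  have : (fun y x => entry p (g y x * h y x)) =
      ∑ k, (fun y x => entry (p.1, k) (g y x)) * (fun y x => entry (k, p.2) (h y x)) := by
    funext y x
    simp [entry, Matrix.mul_apply]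
  rw [this]
  exact sum_mem fun k _ => mul_mem (hg _) (hh _)

lemma paramPoly_entry_param (c : σ → X → ℂ) {g : Y → Mat N} (hg : Continuous g)
    (p : Fin N × Fin N) : (fun y (_ : X) => entry p (g y)) ∈ paramPoly Y c :=
  param_mem_paramPoly c ((entry_continuous p).comp hg)

lemma paramPoly_entry_id (p : Fin N × Fin N) :
    (fun (_ : Y) (A : Mat N) => entry p A) ∈ paramPoly Y (entry (N := N)) :=
  polyFun_mem_paramPoly (polyFun_entry_id p)

end MatrixPolynomials

section Density

variable {N : ℕ}

lemma eq_zero_of_hermitian {f : Mat N → ℂ} (hf : f ∈ polyFun entry)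
    (h : ∀ H : Mat N, H.IsHermitian → f H = 0) (A : Mat N) : f A = 0 := by
  have hpoly : (fun t : Unit → ℂ => f ((realPart A : Mat N) + t () • (imaginaryPart A : Mat N))) ∈
      polyFun (fun (i : Unit) (t : Unit → ℂ) => t i) := by
    refine polyFun_comp hf fun p => ?_
    have : (fun t : Unit → ℂ => entry p ((realPart A : Mat N) + t () • (imaginaryPart A : Mat N))) =
        (fun _ => entry p (realPart A : Mat N)) +
          (fun t : Unit → ℂ => t ()) * fun _ => entry p (imaginaryPart A : Mat N) := by
      funext t
      simp [entry]
    rw [this]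
    exact add_mem (const_mem_polyFun _ _)
      (mul_mem (coord_mem_polyFun (fun (i : Unit) (t : Unit → ℂ) => t i) ()) (const_mem_polyFun _ _))
  obtain ⟨q, hq⟩ := mem_polyFun_iff.1 hpoly
  have hq0 : q = 0 := by
    refine MvPolynomial.funext_set (fun _ => Set.range ((↑) : ℝ → ℂ))
      (fun _ => Set.infinite_range_of_injective Complex.ofReal_injective) fun t ht => ?_
    obtain ⟨r, hr⟩ := ht () trivial
    rw [map_zero]
    refine (hq t).symm.trans (h _ ?_)
    rw [← hr]
    have h1 : (realPart A : Mat N).IsHermitian := (realPart A).2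
    have h2 : (imaginaryPart A : Mat N).IsHermitian := (imaginaryPart A).2
    refine h1.add ?_
    rw [Matrix.IsHermitian, Matrix.conjTranspose_smul, h2.eq]
    simp
  have := hq fun _ => Complex.I
  rw [hq0, map_zero] at this
  rw [← this, realPart_add_I_smul_imaginaryPart]

/-- A polynomial function vanishing on all matrices `V diag(x) V†` with `V` unitary and the `x i`
in a fixed infinite set vanishes. -/
lemma eq_zero_of_conj_diagonal {f : Mat N → ℂ} (hf : f ∈ polyFun entry) {S : Set ℂ}
    (hS : S.Infinite)
    (h : ∀ (V : UN N) (x : Fin N → ℂ), (∀ i, x i ∈ S) →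
      f ((V : Mat N) * diagonal x * star (V : Mat N)) = 0) (A : Mat N) : f A = 0 := by
  have key : ∀ (V : UN N) (x : Fin N → ℂ), f ((V : Mat N) * diagonal x * star (V : Mat N)) = 0 := by
    intro V
    have hpoly : (fun x : Fin N → ℂ => f ((V : Mat N) * diagonal x * star (V : Mat N))) ∈
        polyFun (fun i (x : Fin N → ℂ) => x i) :=
      polyFun_comp hf (polyFun_entry_mul (polyFun_entry_mul (polyFun_entry_const _ _)
        polyFun_entry_diagonal) (polyFun_entry_const _ _))
    obtain ⟨q, hq⟩ := mem_polyFun_iff.1 hpoly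
    have hq0 : q = 0 := by
      refine MvPolynomial.funext_set (fun _ => S) (fun _ => hS) fun x hx => ?_
      rw [map_zero]
      exact (hq x).symm.trans (h V x fun i => hx i trivial)
    intro x
    rw [hq x, hq0, map_zero]
  refine eq_zero_of_hermitian hf (fun H hH => ?_) A
  rw [hH.spectral_theorem, Unitary.conjStarAlgAut_apply]
  exact key _ _

lemma eq_of_unitary {f g : Mat N → ℂ} (hf : f ∈ polyFun entry) (hg : g ∈ polyFun entry)
    (h : ∀ U : UN N, f U = g U) (A : Mat N) : f A = g A := by
  refine sub_eq_zero.1 (eq_zero_of_conj_diagonal (f := f - g) (sub_mem hf hg)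
    (S := (Metric.sphere (0 : ℂ) 1)) ?_ (fun V x hx => ?_) A)
  · refine Set.Infinite.mono (s := Set.range fun t : Set.Ioc (-Real.pi) Real.pi =>
      Complex.exp (t.1 * Complex.I)) ?_ ?_
    · rintro _ ⟨t, rfl⟩
      simp [Complex.norm_exp_ofReal_mul_I]
    · have : Infinite (Set.Ioc (-Real.pi) Real.pi) :=
        (Set.Ioc_infinite (by linarith [Real.pi_pos])).to_subtype
      refine Set.infinite_range_of_injective fun s t hst => ?_
      have := congrArg Complex.arg hst
      simp only [Complex.arg_exp_mul_I] at this
      rw [(toIocMod_eq_self Real.two_pi_pos).2, (toIocMod_eq_self Real.two_pi_pos).2] at this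
      · exact Subtype.ext this
      · exact ⟨t.2.1, by linarith [t.2.2]⟩
      · exact ⟨s.2.1, by linarith [s.2.2]⟩
  · have hD : diagonal x ∈ Matrix.unitaryGroup (Fin N) ℂ := by
      rw [Matrix.mem_unitaryGroup_iff, Matrix.star_eq_conjTranspose,
        Matrix.diagonal_conjTranspose, Matrix.diagonal_mul_diagonal, ← Matrix.diagonal_one]
      congr 1
      funext i
      have := hx i
      rw [mem_sphere_zero_iff_norm] at this
      simp [Complex.mul_conj, Complex.normSq_eq_norm_sq, this]
    have hV := h (V * ⟨diagonal x, hD⟩ * star V)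
    rw [Submonoid.coe_mul, Submonoid.coe_mul, Unitary.coe_star] at hV
    rw [Pi.sub_apply]
    exact sub_eq_zero.2 hV

end Density

section UnitaryGroup

variable {N : ℕ}

instance (N : ℕ) : BorelSpace (UN N) := ⟨rfl⟩

instance (N : ℕ) : CompactSpace (UN N) := by
  refine isCompact_iff_compactSpace.1
    (show IsCompact (Matrix.unitaryGroup (Fin N) ℂ : Set (Mat N)) from ?_)
  have hK : IsCompact {A : Mat N | ∀ i j, A i j ∈ Metric.closedBall (0 : ℂ) 1} := by
    have : {A : Mat N | ∀ i j, A i j ∈ Metric.closedBall (0 : ℂ) 1} =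
        Set.univ.pi fun _ => Set.univ.pi fun _ => Metric.closedBall (0 : ℂ) 1 := by
      ext A
      exact ⟨fun h i _ j _ => h i j, fun h i j => h i trivial j trivial⟩
    rw [this]
    exact isCompact_univ_pi fun _ => isCompact_univ_pi fun _ => isCompact_closedBall _ _
  refine hK.of_isClosed_subset ?_ fun U hU i j => ?_
  · have : (Matrix.unitaryGroup (Fin N) ℂ : Set (Mat N)) = {A | A * star A = 1} := by
      ext A
      exact Matrix.mem_unitaryGroup_iff
    rw [this]
    exact isClosed_eq (continuous_id.mul continuous_star) continuous_const
  · simpa using entry_norm_bound_of_unitary hU i j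

lemma continuous_coe_unitary : Continuous fun U : UN N => (U : Mat N) := continuous_subtype_val

lemma continuous_star_unitary : Continuous fun U : UN N => star (U : Mat N) :=
  continuous_star.comp continuous_subtype_val

lemma coe_mul_star_self (U : UN N) : (U : Mat N) * star (U : Mat N) = 1 :=
  Matrix.mem_unitaryGroup_iff.1 U.2

lemma star_mul_coe_self (U : UN N) : star (U : Mat N) * (U : Mat N) = 1 :=
  Matrix.mem_unitaryGroup_iff'.1 U.2

lemma integrable_of_continuous (μ : Measure (UN N)) [IsFiniteMeasure μ] {f : UN N → ℂ}
    (hf : Continuous f) : Integrable f μ :=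
  hf.integrable_of_hasCompactSupport (HasCompactSupport.of_compactSpace _)

lemma integral_mul_right_unitary (μ : Measure (UN N)) [μ.IsHaarMeasure] [IsProbabilityMeasure μ]
    (f : UN N → ℂ) (V : UN N) : ∫ U, f (U * V) ∂μ = ∫ U, f U ∂μ := by
  have hm : Measurable fun U : UN N => U * V := (continuous_mul_const V).measurable
  have : (μ.map fun U => U * V).IsHaarMeasure := Measure.isHaarMeasure_map_mul_right μ V
  have : IsProbabilityMeasure (μ.map fun U => U * V) :=
    Measure.isProbabilityMeasure_map hm.aemeasurable
  have h := Measure.isHaarMeasure_eq_of_isProbabilityMeasure (μ.map fun U => U * V) μ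
  have h2 := (Homeomorph.mulRight V).measurableEmbedding.integral_map (μ := μ) f
  rw [← show (fun U => U * V) = ⇑(Homeomorph.mulRight V) from rfl, h] at h2
  exact h2.symm

lemma integral_swap_unitary (μ : Measure (UN N)) [IsFiniteMeasure μ] {f : UN N → UN N → ℂ}
    (hf : Continuous (Function.uncurry f)) :
    ∫ U, ∫ V, f U V ∂μ ∂μ = ∫ V, ∫ U, f U V ∂μ ∂μ :=
  integral_integral_swap_of_hasCompactSupport hf (HasCompactSupport.of_compactSpace _)

end UnitaryGroup

end UnitarySchur

namespace UnitarySchur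

open MvPolynomial

section PrincipalMinors

variable {N : ℕ}

lemma eq_zero_of_lower_mul_upper {f : Mat N → ℂ} (hf : f ∈ polyFun entry)
    (h : ∀ L R : Mat N, L.IsLowerTriangular → R.IsUpperTriangular → f (L * R) = 0)
    (A : Mat N) : f A = 0 := by
  open scoped ComplexOrder in
  refine eq_zero_of_conj_diagonal hf (S := Set.range fun t : Set.Ioi (0 : ℝ) => (t.1 : ℂ)) ?_
    (fun V x hx => ?_) A
  · have : Infinite (Set.Ioi (0 : ℝ)) := (Set.Ioi_infinite _).to_subtype
    exact Set.infinite_range_of_injective fun s t hst => Subtype.ext (Complex.ofReal_injective hst)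
  · have hV : IsUnit (V : Mat N) := ⟨⟨V, star (V : Mat N), coe_mul_star_self V,
      star_mul_coe_self V⟩, rfl⟩
    have hS : ((V : Mat N) * diagonal x * star (V : Mat N)).PosDef := by
      rw [hV.posDef_star_right_conjugate_iff, Matrix.posDef_diagonal_iff]
      intro i
      obtain ⟨t, ht⟩ := hx i
      rw [← ht]
      exact Complex.zero_lt_real.2 t.2
    have hlow : (LDL.lower hS).IsLowerTriangular :=
      blockTriangular_inv_of_blockTriangular fun i j hij => LDL.lowerInv_triangular hS hij
    rw [← LDL.lower_conj_diag hS]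
    refine h _ _ (hlow.mul (blockTriangular_diagonal _)) fun i j hij => ?_
    rw [Matrix.conjTranspose_apply, hlow hij, star_zero]

/-- The projection onto the first `k` coordinates. -/
def truncation (N k : ℕ) : Mat N := diagonal fun i => if (i : ℕ) < k then 1 else 0

/-- The `k`-th leading principal minor. -/
def leadingMinor (k : ℕ) (A : Mat N) : ℂ :=
  (truncation N k * A * truncation N k + (1 - truncation N k)).det

lemma truncation_mul_self (k : ℕ) : truncation N k * truncation N k = truncation N k := by
  simp [truncation, Matrix.diagonal_mul_diagonal]

lemma truncation_mul_lower (k : ℕ) {L : Mat N} (hL : L.IsLowerTriangular) :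
    truncation N k * L = truncation N k * L * truncation N k := by
  ext i j
  simp only [truncation, Matrix.diagonal_mul, Matrix.mul_diagonal]
  split_ifs with h1 h2 <;> simp
  exact hL (i := i) (j := j) (show (i : ℕ) < j by omega)

/-- Powers of the diagonal entries. -/
def diagPow (μ : Fin N → ℕ) (A : Mat N) : ℂ := ∏ i, A i i ^ μ i

lemma leadingMinor_lower_mul (k : ℕ) {L : Mat N} (hL : L.IsLowerTriangular) (A : Mat N) :
    leadingMinor k (L * A) = (∏ i : Fin N, if (i : ℕ) < k then L i i else 1) * leadingMinor k A := by
  have hp := truncation_mul_self (N := N) k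
  have hpL := truncation_mul_lower k hL
  have h1 : (∏ i : Fin N, if (i : ℕ) < k then L i i else 1) =
      (truncation N k * L * truncation N k + (1 - truncation N k)).det := by
    rw [det_of_isLowerTriangular]
    · refine Finset.prod_congr rfl fun i _ => ?_
      simp [truncation]
      split_ifs <;> simp
    · exact ((((blockTriangular_diagonal _).mul hL).mul (blockTriangular_diagonal _))).add
        (blockTriangular_one.sub (blockTriangular_diagonal _))
  rw [h1, leadingMinor, leadingMinor, ← Matrix.det_mul]
  congr 1
  set p := truncation N k
  have hp' : ∀ X : Mat N, p * (p * X) = p * X := fun X => by rw [← Matrix.mul_assoc, hp]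
  have h2 : p * (L * A) * p = p * L * p * (p * A * p) := by
    rw [← Matrix.mul_assoc p L A, hpL]
    simp only [Matrix.mul_assoc, hp']
  rw [h2]
  have e1 : p * L * p * (1 - p) = 0 := by rw [Matrix.mul_sub, Matrix.mul_assoc _ p p, hp]; simp
  have e2 : (1 - p) * (p * A * p) = 0 := by
    rw [Matrix.sub_mul, Matrix.one_mul, Matrix.mul_assoc, hp', sub_self]
  have e3 : (1 - p) * (1 - p) = 1 - p := by
    rw [Matrix.sub_mul, Matrix.mul_sub, Matrix.mul_sub, hp]; simp
  rw [Matrix.add_mul, Matrix.mul_add, Matrix.mul_add, e1, e2, e3]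
  simp

lemma leadingMinor_transpose (k : ℕ) (A : Mat N) : leadingMinor k Aᵀ = leadingMinor k A := by
  rw [leadingMinor, ← Matrix.det_transpose]
  simp [truncation, leadingMinor, Matrix.mul_assoc]

lemma leadingMinor_mul_upper (k : ℕ) {R : Mat N} (hR : R.IsUpperTriangular) (A : Mat N) :
    leadingMinor k (A * R) = (∏ i : Fin N, if (i : ℕ) < k then R i i else 1) * leadingMinor k A := by
  rw [← leadingMinor_transpose, Matrix.transpose_mul, leadingMinor_lower_mul k hR.transpose,
    leadingMinor_transpose]
  rfl

lemma leadingMinor_one (k : ℕ) : leadingMinor k (1 : Mat N) = 1 := by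
  simp [leadingMinor, truncation_mul_self]

lemma leadingMinor_star (k : ℕ) (A : Mat N) :
    leadingMinor k (star A) = star (leadingMinor k A) := by
  have : star (truncation N k) = truncation N k := by
    simp [truncation, Matrix.star_eq_conjTranspose, Matrix.diagonal_conjTranspose]
  rw [leadingMinor, leadingMinor, ← Matrix.det_conjTranspose, ← Matrix.star_eq_conjTranspose]
  simp only [star_add, star_mul, star_sub, star_one, this, Matrix.mul_assoc]

lemma leadingMinor_mem_polyFun (k : ℕ) : leadingMinor (N := N) k ∈ polyFun entry := by
  refine polyFun_det fun i j => ?_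
  refine add_mem (polyFun_entry_mul (polyFun_entry_mul (polyFun_entry_const _ _)
    polyFun_entry_id) (polyFun_entry_const _ _) (i, j)) (const_mem_polyFun _ _)

end PrincipalMinors

section HighestWeight

variable {N : ℕ}

/-- Extension of a finite sequence by zero. -/
def extendZero (μ : Fin N → ℕ) (k : ℕ) : ℕ := if h : k < N then μ ⟨k, h⟩ else 0

/-- The product of powers of leading principal minors which is a highest weight vector of
weight `μ`. -/
def hwPoly (μ : Fin N → ℕ) (A : Mat N) : ℂ :=
  ∏ k : Fin N, leadingMinor (k + 1) A ^ (μ k - extendZero μ (k + 1))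

lemma sum_extendZero {μ : Fin N → ℕ} (hμ : Antitone μ) (i : Fin N) :
    ∑ k : Fin N, (if (i : ℕ) < k + 1 then μ k - extendZero μ (k + 1) else 0) = μ i := by
  have h0 : ∀ n, (i : ℕ) ≤ n → (∑ k ∈ Finset.range n, if (i : ℕ) < k + 1 then
      extendZero μ k - extendZero μ (k + 1) else 0) + extendZero μ n = extendZero μ i := by
    intro n hn
    induction n, hn using Nat.le_induction with
    | base =>
      rw [Finset.sum_eq_zero, zero_add]
      intro k hk
      rw [Finset.mem_range] at hk
      rw [if_neg (by omega)]
    | succ n hn ih =>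
      rw [Finset.sum_range_succ, if_pos (by omega), ← ih]
      have : extendZero μ (n + 1) ≤ extendZero μ n := by
        unfold extendZero
        split_ifs with h1 h2
        · exact hμ (Fin.mk_le_mk.2 (Nat.le_succ n))
        · omega
        · exact Nat.zero_le _
        · exact le_rfl
      omega
  have h1 := h0 N i.2.le
  have h2 : ∀ k : Fin N, extendZero μ k = μ k := fun k => by simp [extendZero]
  have h3 : extendZero μ N = 0 := by simp [extendZero]
  rw [h3, add_zero, h2, Finset.sum_range] at h1
  simpa only [h2] using h1

lemma prod_ite_pow {μ : Fin N → ℕ} (hμ : Antitone μ) (x : Fin N → ℂ) :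
    ∏ k : Fin N, (∏ i : Fin N, if (i : ℕ) < k + 1 then x i else 1) ^
      (μ k - extendZero μ (k + 1)) = ∏ i, x i ^ μ i := by
  simp only [← Finset.prod_pow]
  rw [Finset.prod_comm]
  refine Finset.prod_congr rfl fun i _ => ?_
  rw [← sum_extendZero hμ i, ← Finset.prod_pow_eq_pow_sum]
  refine Finset.prod_congr rfl fun k _ => ?_
  split_ifs <;> simp

lemma hwPoly_lower_mul {μ : Fin N → ℕ} (hμ : Antitone μ) {L : Mat N} (hL : L.IsLowerTriangular)
    (A : Mat N) : hwPoly μ (L * A) = diagPow μ L * hwPoly μ A := by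
  simp only [hwPoly, leadingMinor_lower_mul _ hL, mul_pow, Finset.prod_mul_distrib]
  rw [prod_ite_pow hμ fun i => L i i]
  rfl

lemma hwPoly_mul_upper {μ : Fin N → ℕ} (hμ : Antitone μ) {R : Mat N} (hR : R.IsUpperTriangular)
    (A : Mat N) : hwPoly μ (A * R) = diagPow μ R * hwPoly μ A := by
  simp only [hwPoly, leadingMinor_mul_upper _ hR, mul_pow, Finset.prod_mul_distrib]
  rw [prod_ite_pow hμ fun i => R i i]
  rfl

lemma hwPoly_one (μ : Fin N → ℕ) : hwPoly μ (1 : Mat N) = 1 := by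
  simp [hwPoly, leadingMinor_one]

lemma hwPoly_star (μ : Fin N → ℕ) (A : Mat N) : hwPoly μ (star A) = star (hwPoly μ A) := by
  simp [hwPoly, leadingMinor_star]

lemma hwPoly_mem_polyFun (μ : Fin N → ℕ) : hwPoly μ ∈ polyFun (entry (N := N)) := by
  have : hwPoly μ = ∏ k : Fin N, leadingMinor (N := N) (k + 1) ^
      (μ k - extendZero μ (k + 1)) := by
    funext A
    simp [hwPoly]
  rw [this]
  exact prod_mem fun k _ => pow_mem (leadingMinor_mem_polyFun _) _

lemma hwPoly_unique {μ : Fin N → ℕ} (hμ : Antitone μ) {f : Mat N → ℂ} (hf : f ∈ polyFun entry)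
    (h : ∀ L R : Mat N, L.IsLowerTriangular → R.IsUpperTriangular →
      f (L * R) = diagPow μ L * (diagPow μ R * f 1)) (A : Mat N) :
    f A = f 1 * hwPoly μ A := by
  refine sub_eq_zero.1 (eq_zero_of_lower_mul_upper (f := f - (fun _ => f 1) * hwPoly μ)
    (sub_mem hf (mul_mem (const_mem_polyFun _ _) (hwPoly_mem_polyFun μ))) (fun L R hL hR => ?_) A)
  have : hwPoly μ (L * R) = diagPow μ L * diagPow μ R := by
    have h1 := hwPoly_mul_upper hμ hR 1
    rw [hwPoly_lower_mul hμ hL, ← mul_one (diagPow μ R), ← hwPoly_one μ, ← h1, one_mul]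
  simp only [Pi.sub_apply, Pi.mul_apply, this, h L R hL hR]
  ring

lemma hwPoly_add_const {μ : Fin N → ℕ} (hμ : Antitone μ) (q : ℕ) (A : Mat N) :
    hwPoly (fun i => μ i + q) A = A.det ^ q * hwPoly μ A := by
  have hdet : (fun A : Mat N => A.det) ∈ polyFun (entry (N := N)) :=
    polyFun_det fun i j => coord_mem_polyFun _ (i, j)
  have h2 : ∀ X : Mat N, diagPow (fun i => μ i + q) X = (∏ i, X i i) ^ q * diagPow μ X := by
    intro X
    simp only [diagPow, pow_add, Finset.prod_mul_distrib, Finset.prod_pow]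
    ring
  have h := hwPoly_unique (μ := fun i => μ i + q) (fun i j hij => Nat.add_le_add_right (hμ hij) q)
    (f := (fun A : Mat N => A.det) ^ q * hwPoly μ)
    (mul_mem (pow_mem hdet q) (hwPoly_mem_polyFun μ)) (fun L R hL hR => by
      simp only [Pi.mul_apply, Pi.pow_apply, h2, Matrix.det_mul, Matrix.det_one,
        det_of_isLowerTriangular L hL, det_of_isUpperTriangular hR, hwPoly_lower_mul hμ hL]
      rw [← one_mul R, hwPoly_mul_upper hμ hR]
      simp only [one_mul, hwPoly_one]
      ring) A
  simp only [Pi.mul_apply, Pi.pow_apply, Matrix.det_one, hwPoly_one, one_pow, one_mul] at h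
  exact h.symm

end HighestWeight

end UnitarySchur

namespace UnitarySchur

open MvPolynomial

section Orthogonality

variable {N : ℕ}

lemma polyFun_left_right {f : Mat N → ℂ} (hf : f ∈ polyFun entry) (A C : Mat N) :
    (fun X => f (A * X * C)) ∈ polyFun entry :=
  polyFun_comp hf (polyFun_entry_mul (polyFun_entry_mul (polyFun_entry_const _ _)
    polyFun_entry_id) (polyFun_entry_const _ _))

lemma integral_left_right_mem_polyFun (ν : Measure (UN N)) [IsFiniteMeasure ν]
    {f : Mat N → ℂ} (hf : f ∈ polyFun entry) {a b : UN N → Mat N} (ha : Continuous a)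
    (hb : Continuous b) {g : UN N → ℂ} (hg : Continuous g) :
    (fun X : Mat N => ∫ U, f (a U * X * b U) * g U ∂ν) ∈ polyFun entry :=
  integral_mem_polyFun ν (mul_mem (paramPoly_comp hf (paramPoly_entry_mul (paramPoly_entry_mul
    (paramPoly_entry_param _ ha) paramPoly_entry_id) (paramPoly_entry_param _ hb)))
    (param_mem_paramPoly _ hg))

lemma integral_move (ν : Measure (UN N)) [ν.IsHaarMeasure] [IsProbabilityMeasure ν]
    {f g : Mat N → ℂ} (hf : f ∈ polyFun entry) (hg : g ∈ polyFun entry) (A C : Mat N) :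
    ∫ U : UN N, f U * g (A * star (U : Mat N) * C) ∂ν =
      ∫ U : UN N, f (C * (U : Mat N) * A) * g (star (U : Mat N)) ∂ν := by
  have hfc := matPoly_continuous hf
  have hgc := matPoly_continuous hg
  have base : ∀ A C : UN N, ∫ U : UN N, f U * g ((A : Mat N) * star (U : Mat N) * C) ∂ν =
      ∫ U : UN N, f ((C : Mat N) * U * A) * g (star (U : Mat N)) ∂ν := by
    intro A C
    rw [← integral_mul_right_unitary ν _ A, ← integral_mul_left_eq_self _ C]
    refine integral_congr_ae (Filter.Eventually.of_forall fun U => ?_)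
    simp only [Submonoid.coe_mul, star_mul]
    congr 2
    calc (A : Mat N) * (star (A : Mat N) * (star (U : Mat N) * star (C : Mat N))) * C
        = ((A : Mat N) * star (A : Mat N)) * star (U : Mat N) * (star (C : Mat N) * C) := by
          simp only [Matrix.mul_assoc]
      _ = _ := by rw [coe_mul_star_self, star_mul_coe_self, one_mul, mul_one]
  have l1 : ∀ B : Mat N, (fun A => ∫ U : UN N, f U * g (A * star (U : Mat N) * B) ∂ν) ∈
      polyFun entry := by
    intro B
    have := integral_left_right_mem_polyFun ν hg (a := fun _ => 1)
      (b := fun U => star (U : Mat N) * B) continuous_const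
      (continuous_star_unitary.mul continuous_const) (hfc.comp continuous_coe_unitary)
    simpa only [one_mul, ← mul_assoc, mul_comm, Function.comp_def] using this
  have l2 : ∀ B : Mat N, (fun C => ∫ U : UN N, f U * g (B * star (U : Mat N) * C) ∂ν) ∈
      polyFun entry := by
    intro B
    have := integral_left_right_mem_polyFun ν hg (a := fun U => B * star (U : Mat N))
      (b := fun _ => 1) (continuous_const.mul continuous_star_unitary)
      continuous_const (hfc.comp continuous_coe_unitary)
    simpa only [mul_one, mul_comm (g _), Function.comp_def] using this
  have r1 : ∀ B : Mat N, (fun A => ∫ U : UN N, f (B * (U : Mat N) * A) * g (star (U : Mat N)) ∂ν) ∈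
      polyFun entry := by
    intro B
    have := integral_left_right_mem_polyFun ν hf (a := fun U => B * (U : Mat N))
      (b := fun _ => 1) (continuous_const.mul continuous_coe_unitary)
      continuous_const (hgc.comp continuous_star_unitary)
    simpa only [mul_one, Function.comp_def] using this
  have r2 : ∀ B : Mat N, (fun C => ∫ U : UN N, f (C * (U : Mat N) * B) * g (star (U : Mat N)) ∂ν) ∈
      polyFun entry := by
    intro B
    have := integral_left_right_mem_polyFun ν hf (a := fun U => 1)
      (b := fun U => (U : Mat N) * B) continuous_const
      (continuous_coe_unitary.mul continuous_const) (hgc.comp continuous_star_unitary)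
    simpa only [one_mul, ← mul_assoc, Function.comp_def] using this
  have step : ∀ (A : Mat N) (C : UN N), ∫ U : UN N, f U * g (A * star (U : Mat N) * C) ∂ν =
      ∫ U : UN N, f ((C : Mat N) * U * A) * g (star (U : Mat N)) ∂ν :=
    fun A C => eq_of_unitary (l1 C) (r1 C) (fun A => base A C) A
  exact eq_of_unitary (l2 A) (r2 A) (fun C => step A C) C

/-- The squared norm of the highest weight vector `hwPoly μ`. -/
def hwNorm (ν : Measure (UN N)) (μ : Fin N → ℕ) : ℂ :=
  ∫ U : UN N, hwPoly μ (U : Mat N) * hwPoly μ (star (U : Mat N)) ∂ν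

lemma hwNorm_eq (ν : Measure (UN N)) (μ : Fin N → ℕ) :
    hwNorm ν μ = ((∫ U : UN N, ‖hwPoly μ (U : Mat N)‖ ^ 2 ∂ν : ℝ) : ℂ) := by
  rw [hwNorm, ← integral_complex_ofReal]
  refine integral_congr_ae (Filter.Eventually.of_forall fun U => ?_)
  simp only [hwPoly_star]
  rw [← starRingEnd_apply, Complex.mul_conj, Complex.normSq_eq_norm_sq]

lemma hwNorm_ne_zero (ν : Measure (UN N)) [ν.IsHaarMeasure] (μ : Fin N → ℕ) :
    hwNorm ν μ ≠ 0 := by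
  rw [hwNorm_eq, Complex.ofReal_ne_zero]
  refine (Continuous.integral_pos_of_hasCompactSupport_nonneg_nonzero (x := (1 : UN N)) ?_
    (HasCompactSupport.of_compactSpace _) (fun U => sq_nonneg _) ?_).ne'
  · exact ((matPoly_continuous (hwPoly_mem_polyFun μ)).comp continuous_coe_unitary).norm.pow 2
  · simp [hwPoly_one]

lemma hwNorm_add_const (ν : Measure (UN N)) {μ : Fin N → ℕ} (hμ : Antitone μ) (q : ℕ) :
    hwNorm ν (fun i => μ i + q) = hwNorm ν μ := by
  refine integral_congr_ae (Filter.Eventually.of_forall fun U => ?_)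
  have h : (U : Mat N).det * (star (U : Mat N)).det = 1 := by
    rw [← Matrix.det_mul, coe_mul_star_self, Matrix.det_one]
  simp only [hwPoly_add_const hμ]
  rw [mul_mul_mul_comm, ← mul_pow, h, one_pow, one_mul]

lemma diagPow_one (α : Fin N → ℕ) : diagPow α 1 = 1 := by simp [diagPow]

lemma biequivariant_eq_zero {f : Mat N → ℂ} (hf : f ∈ polyFun entry) {α β : Fin N → ℕ}
    (hαβ : α ≠ β)
    (hL : ∀ L A : Mat N, L.IsLowerTriangular → f (L * A) = diagPow α L * f A)
    (hR : ∀ A R : Mat N, R.IsUpperTriangular → f (A * R) = diagPow β R * f A) (A : Mat N) :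
    f A = 0 := by
  have h1 : f 1 = 0 := by
    obtain ⟨i, hi⟩ := Function.ne_iff.1 hαβ
    have key : ∀ γ : Fin N → ℕ, diagPow γ (diagonal (Function.update 1 i (2 : ℂ))) = 2 ^ γ i := by
      intro γ
      rw [diagPow, Finset.prod_eq_single i]
      · simp
      · intro j _ hj
        simp [Function.update_of_ne hj]
      · simp
    have e1 := hL (diagonal (Function.update 1 i (2 : ℂ))) 1 (blockTriangular_diagonal _)
    have e2 := hR 1 (diagonal (Function.update 1 i (2 : ℂ))) (blockTriangular_diagonal _)
    rw [mul_one, key] at e1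
    rw [one_mul, key] at e2
    have e3 : ((2 : ℂ) ^ α i - 2 ^ β i) * f 1 = 0 := by rw [sub_mul, ← e1, ← e2, sub_self]
    refine (mul_eq_zero.1 e3).resolve_left fun h => hi ?_
    have : (2 : ℕ) ^ α i = 2 ^ β i := by exact_mod_cast sub_eq_zero.1 h
    exact Nat.pow_right_injective le_rfl this
  refine eq_zero_of_lower_mul_upper hf (fun L R hl hr => ?_) A
  rw [hL _ _ hl, ← one_mul R, hR _ _ hr, h1, mul_zero, mul_zero]

lemma biequivariant_eq {f : Mat N → ℂ} (hf : f ∈ polyFun entry) {α : Fin N → ℕ}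
    (hα : Antitone α)
    (hL : ∀ L A : Mat N, L.IsLowerTriangular → f (L * A) = diagPow α L * f A)
    (hR : ∀ A R : Mat N, R.IsUpperTriangular → f (A * R) = diagPow α R * f A) (A : Mat N) :
    f A = f 1 * hwPoly α A :=
  hwPoly_unique hα hf (fun L R hl hr => by rw [hL _ _ hl, ← hR _ _ hr, one_mul]) A

lemma hwPoly_orthogonality_aux (ν : Measure (UN N)) [ν.IsHaarMeasure] [IsProbabilityMeasure ν]
    {α β : Fin N → ℕ} (hα : Antitone α) (hβ : Antitone β) (A C : Mat N) :
    ∫ U : UN N, hwPoly α (A * (U : Mat N) * C) * hwPoly β (star (U : Mat N)) ∂ν =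
      if α = β then hwNorm ν β * hwPoly β A * hwPoly β C else 0 := by
  have hpα := hwPoly_mem_polyFun α
  have hpβ := hwPoly_mem_polyFun β
  have hcα := matPoly_continuous hpα
  have hcβ := matPoly_continuous hpβ
  have hL : ∀ A L C : Mat N, L.IsLowerTriangular →
      ∫ U : UN N, hwPoly α (A * (U : Mat N) * (L * C)) * hwPoly β (star (U : Mat N)) ∂ν =
      diagPow β L *
        ∫ U : UN N, hwPoly α (A * (U : Mat N) * C) * hwPoly β (star (U : Mat N)) ∂ν := by
    intro A L C hl
    rw [← integral_move ν hpα hpβ, ← integral_move ν hpα hpβ, ← integral_const_mul]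
    refine integral_congr_ae (Filter.Eventually.of_forall fun U => ?_)
    simp only [Matrix.mul_assoc L, hwPoly_lower_mul hβ hl]
    ring
  have hR : ∀ A C R : Mat N, R.IsUpperTriangular →
      ∫ U : UN N, hwPoly α (A * (U : Mat N) * (C * R)) * hwPoly β (star (U : Mat N)) ∂ν =
      diagPow α R *
        ∫ U : UN N, hwPoly α (A * (U : Mat N) * C) * hwPoly β (star (U : Mat N)) ∂ν := by
    intro A C R hr
    rw [← integral_const_mul]
    refine integral_congr_ae (Filter.Eventually.of_forall fun U => ?_)
    simp only [← Matrix.mul_assoc, hwPoly_mul_upper hα hr]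
    ring
  have hL' : ∀ L A : Mat N, L.IsLowerTriangular →
      ∫ U : UN N, hwPoly α (L * A * (U : Mat N) * 1) * hwPoly β (star (U : Mat N)) ∂ν =
      diagPow α L *
        ∫ U : UN N, hwPoly α (A * (U : Mat N) * 1) * hwPoly β (star (U : Mat N)) ∂ν := by
    intro L A hl
    rw [← integral_const_mul]
    simp only [hwPoly_lower_mul hα hl, mul_assoc]
  have hR' : ∀ A R : Mat N, R.IsUpperTriangular →
      ∫ U : UN N, hwPoly α (A * R * (U : Mat N) * 1) * hwPoly β (star (U : Mat N)) ∂ν =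
      diagPow β R *
        ∫ U : UN N, hwPoly α (A * (U : Mat N) * 1) * hwPoly β (star (U : Mat N)) ∂ν := by
    intro A R hr
    rw [← integral_move ν hpα hpβ, ← integral_move ν hpα hpβ, ← integral_const_mul]
    refine integral_congr_ae (Filter.Eventually.of_forall fun U => ?_)
    simp only [← Matrix.mul_assoc, hwPoly_mul_upper hβ hr]
    ring
  have hpoly : (fun C => ∫ U : UN N, hwPoly α (A * (U : Mat N) * C) *
      hwPoly β (star (U : Mat N)) ∂ν) ∈ polyFun entry := by
    have := integral_left_right_mem_polyFun ν hpα (a := fun U => A * (U : Mat N))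
      (b := fun _ => 1) (continuous_const.mul continuous_coe_unitary)
      continuous_const (hcβ.comp continuous_star_unitary)
    simpa only [mul_one, Function.comp_def] using this
  have hpoly' : (fun A => ∫ U : UN N, hwPoly α (A * (U : Mat N) * 1) *
      hwPoly β (star (U : Mat N)) ∂ν) ∈ polyFun entry := by
    have := integral_left_right_mem_polyFun ν hpα (a := fun _ => 1)
      (b := fun U => (U : Mat N)) continuous_const continuous_coe_unitary
      (hcβ.comp continuous_star_unitary)
    simpa only [mul_one, one_mul, Function.comp_def] using this
  split_ifs with h
  · subst h
    rw [biequivariant_eq hpoly hβ (fun L C => hL A L C) (fun C R => hR A C R) C,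
      biequivariant_eq hpoly' hβ hL' hR' A]
    simp only [one_mul, mul_one]
    rfl
  · exact biequivariant_eq_zero hpoly (Ne.symm h) (fun L C => hL A L C) (fun C R => hR A C R) C

/-- Orthogonality of the matrix coefficients of highest weight vectors. -/
lemma hwPoly_orthogonality (ν : Measure (UN N)) [ν.IsHaarMeasure] [IsProbabilityMeasure ν]
    {α β : Fin N → ℕ} (hα : Antitone α) (hβ : Antitone β) (A C A' C' : Mat N) :
    ∫ U : UN N, hwPoly α (A * (U : Mat N) * C) * hwPoly β (A' * star (U : Mat N) * C') ∂ν =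
      if α = β then hwNorm ν β * hwPoly β (A * C') * hwPoly β (A' * C) else 0 := by
  rw [integral_move ν (polyFun_left_right (hwPoly_mem_polyFun α) A C) (hwPoly_mem_polyFun β),
    ← hwPoly_orthogonality_aux ν hα hβ]
  simp only [Matrix.mul_assoc]

end Orthogonality

end UnitarySchur

namespace UnitarySchur

open MvPolynomial

section Weights

variable {σ τ : Type*} [Fintype σ] [Fintype τ]

lemma prod_update_pow {τ : Type*} [Fintype τ] [DecidableEq τ] (t : τ) (b : τ → ℕ) :
    ∏ s, Function.update (1 : τ → ℂ) t 2 s ^ b s = 2 ^ b t := by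
  rw [Finset.prod_eq_single t]
  · simp
  · intro j _ hj
    simp [Function.update_of_ne hj]
  · simp

lemma prod_comp_pow (g : σ → τ) (d : τ → ℂ) (m : σ →₀ ℕ) :
    ∏ p, d (g p) ^ m p = ∏ t, d t ^ (m.mapDomain g) t := by
  have h1 := Finsupp.prod_mapDomain_index (f := g) (s := m) (h := fun t k => d t ^ k)
    (fun _ => pow_zero _) (fun _ _ _ => pow_add _ _ _)
  rw [Finsupp.prod_fintype _ _ (fun _ => pow_zero _),
    Finsupp.prod_fintype _ _ (fun _ => pow_zero _)] at h1
  exact h1.symm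

/-- The polynomial obtained by rescaling the variables. -/
def rescale (d : σ → ℂ) (P : MvPolynomial σ ℂ) : MvPolynomial σ ℂ :=
  ∑ m ∈ P.support, monomial m (P.coeff m * ∏ p, d p ^ m p)

lemma eval_rescale (d x : σ → ℂ) (P : MvPolynomial σ ℂ) :
    eval x (rescale d P) = eval (fun p => d p * x p) P := by
  rw [rescale, map_sum, eval_eq']
  refine Finset.sum_congr rfl fun m _ => ?_
  rw [eval_monomial, Finsupp.prod_fintype _ _ (fun _ => pow_zero _)]
  simp only [mul_pow, Finset.prod_mul_distrib, mul_assoc]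

lemma coeff_rescale (d : σ → ℂ) (P : MvPolynomial σ ℂ) (m : σ →₀ ℕ) :
    coeff m (rescale d P) = P.coeff m * ∏ p, d p ^ m p := by
  rw [rescale, coeff_sum]
  simp only [coeff_monomial]
  rw [Finset.sum_ite_eq']
  split_ifs with h
  · rfl
  · rw [MvPolynomial.notMem_support_iff.1 h, zero_mul]

lemma mapDomain_eq_of_equivariant (g : σ → τ) (a : τ →₀ ℕ) {P : MvPolynomial σ ℂ}
    (h : ∀ (d : τ → ℂ) (x : σ → ℂ),
      eval (fun p => d (g p) * x p) P = (∏ t, d t ^ a t) * eval x P)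
    {m : σ →₀ ℕ} (hm : m ∈ P.support) : m.mapDomain g = a := by
  ext t
  have h1 : rescale (fun p => Function.update (1 : τ → ℂ) t 2 (g p)) P = MvPolynomial.C (2 ^ a t) * P := by
    refine MvPolynomial.funext fun x => ?_
    rw [eval_rescale, h, prod_update_pow, map_mul, eval_C]
  have h2 := congrArg (coeff m) h1
  rw [coeff_rescale, prod_comp_pow, prod_update_pow, coeff_C_mul, mul_comm] at h2
  have h3 := mul_right_cancel₀ (MvPolynomial.mem_support_iff.1 hm) h2
  have h4 : (2 : ℕ) ^ (m.mapDomain g) t = 2 ^ a t := by exact_mod_cast h3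
  exact Nat.pow_right_injective le_rfl h4

end Weights

section LowerEquivariant

variable {N : ℕ}

/-- A weight, as a finitely supported function. -/
def toWeight (κ : Fin N → ℕ) : Fin N →₀ ℕ := Finsupp.equivFunOnFinite.symm κ

@[simp]
lemma toWeight_apply (κ : Fin N → ℕ) (i : Fin N) : toWeight κ i = κ i := rfl

lemma toWeight_injective : Function.Injective (toWeight (N := N)) :=
  Finsupp.equivFunOnFinite.symm.injective

/-- The lexicographic order on weights. -/
abbrev lexOrder (N : ℕ) : MonomialOrder (Fin N) := MonomialOrder.lex

/-- Comparison of weights in the lexicographic order. -/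
def LexLE (a b : Fin N →₀ ℕ) : Prop := (lexOrder N).toSyn a ≤ (lexOrder N).toSyn b

/-- The value of a polynomial at a matrix. -/
def matEval (P : MvPolynomial (Fin N × Fin N) ℂ) (Z : Mat N) : ℂ := eval (fun p => entry p Z) P

lemma matEval_eq (P : MvPolynomial (Fin N × Fin N) ℂ) (Z : Mat N) :
    matEval P Z = ∑ m ∈ P.support, P.coeff m * ∏ p, entry p Z ^ m p := eval_eq' _ _

lemma matEval_mem_polyFun (P : MvPolynomial (Fin N × Fin N) ℂ) : matEval P ∈ polyFun entry :=
  mem_polyFun_iff.2 ⟨P, fun _ => rfl⟩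

lemma matEval_of (P : MvPolynomial (Fin N × Fin N) ℂ) (x : Fin N × Fin N → ℂ) :
    matEval P (Matrix.of fun i j => x (i, j)) = eval x P := rfl

lemma eq_of_matEval {P Q : MvPolynomial (Fin N × Fin N) ℂ} (h : ∀ Z, matEval P Z = matEval Q Z) :
    P = Q :=
  MvPolynomial.funext fun x => h (Matrix.of fun i j => x (i, j))

lemma single_lexLT {i j : Fin N} (h : i < j) :
    (lexOrder N).toSyn (Finsupp.single j 1) < (lexOrder N).toSyn (Finsupp.single i 1) :=
  MonomialOrder.lex_lt_iff.2 (Finsupp.Lex.single_lt_iff.2 h)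

lemma single_lexLE {i j : Fin N} (h : i ≤ j) :
    (lexOrder N).toSyn (Finsupp.single j 1) ≤ (lexOrder N).toSyn (Finsupp.single i 1) :=
  h.eq_or_lt.elim (fun h => by rw [h]) fun h => (single_lexLT h).le

lemma mapDomain_eq_sum {σ τ : Type*} [Fintype σ] (g : σ → τ) (m : σ →₀ ℕ) :
    m.mapDomain g = ∑ p, m p • Finsupp.single (g p) 1 := by
  rw [Finsupp.mapDomain, Finsupp.sum_fintype _ _ (by simp)]
  simp

lemma colWeight_lexLE {m : Fin N × Fin N →₀ ℕ} (hm : ∀ p, m p ≠ 0 → p.1 ≤ p.2) :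
    LexLE (m.mapDomain Prod.snd) (m.mapDomain Prod.fst) := by
  rw [LexLE, mapDomain_eq_sum, mapDomain_eq_sum, map_sum, map_sum]
  refine Finset.sum_le_sum fun p _ => ?_
  rw [map_nsmul, map_nsmul]
  by_cases hp : m p = 0
  · rw [hp, zero_smul, zero_smul]
  · exact nsmul_le_nsmul_right (single_lexLE (hm p hp)) _

lemma diagonal_of_colWeight_eq {m : Fin N × Fin N →₀ ℕ} (hm : ∀ p, m p ≠ 0 → p.1 ≤ p.2)
    (h : m.mapDomain Prod.snd = m.mapDomain Prod.fst) {p : Fin N × Fin N} (hp : m p ≠ 0) :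
    p.1 = p.2 := by
  by_contra hne
  refine absurd (congrArg (lexOrder N).toSyn h) (ne_of_lt ?_)
  rw [mapDomain_eq_sum, mapDomain_eq_sum, map_sum, map_sum]
  refine Finset.sum_lt_sum (fun p _ => ?_) ⟨p, Finset.mem_univ _, ?_⟩
  · rw [map_nsmul, map_nsmul]
    by_cases hp : m p = 0
    · rw [hp, zero_smul, zero_smul]
    · exact nsmul_le_nsmul_right (single_lexLE (hm p hp)) _
  · rw [map_nsmul, map_nsmul]
    exact nsmul_lt_nsmul_right hp (single_lexLT (lt_of_le_of_ne (hm p hp) hne))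

/-- The component of column weight `a` of a polynomial on matrices. -/
def colCoeff (P : MvPolynomial (Fin N × Fin N) ℂ) (a : Fin N →₀ ℕ) (Z : Mat N) : ℂ :=
  ∑ m ∈ P.support with m.mapDomain Prod.snd = a, P.coeff m * ∏ p, entry p Z ^ m p

/-- The polynomial `s ↦ P(Z diag(s))`. -/
def colPoly (P : MvPolynomial (Fin N × Fin N) ℂ) (Z : Mat N) : MvPolynomial (Fin N) ℂ :=
  ∑ m ∈ P.support, monomial (m.mapDomain Prod.snd) (P.coeff m * ∏ p, entry p Z ^ m p)

lemma coeff_colPoly (P : MvPolynomial (Fin N × Fin N) ℂ) (a : Fin N →₀ ℕ) (Z : Mat N) :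
    coeff a (colPoly P Z) = colCoeff P a Z := by
  rw [colPoly, coeff_sum, colCoeff, Finset.sum_filter]
  exact Finset.sum_congr rfl fun m _ => coeff_monomial _ _ _

lemma eval_colPoly (P : MvPolynomial (Fin N × Fin N) ℂ) (Z : Mat N) (s : Fin N → ℂ) :
    eval s (colPoly P Z) = matEval P (Z * diagonal s) := by
  rw [colPoly, map_sum, matEval_eq]
  refine Finset.sum_congr rfl fun m _ => ?_
  rw [eval_monomial, Finsupp.prod_fintype _ _ (fun _ => pow_zero _), ← prod_comp_pow]
  simp only [entry, Matrix.mul_diagonal, mul_pow, Finset.prod_mul_distrib, mul_assoc]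

lemma colCoeff_mem_polyFun (P : MvPolynomial (Fin N × Fin N) ℂ) (a : Fin N →₀ ℕ) :
    colCoeff P a ∈ polyFun entry := by
  have : colCoeff P a = ∑ m ∈ P.support with m.mapDomain Prod.snd = a,
      (fun _ => P.coeff m) * ∏ p, entry p ^ m p := by
    funext Z
    simp [colCoeff]
  rw [this]
  exact sum_mem fun m _ => mul_mem (const_mem_polyFun _ _)
    (prod_mem fun p _ => pow_mem (coord_mem_polyFun _ _) _)

/-- `f` is equivariant of weight `κ` under left multiplication by lower triangular matrices. -/
def LowerEquivariant (κ : Fin N → ℕ) (f : Mat N → ℂ) : Prop :=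
  ∀ L Z : Mat N, L.IsLowerTriangular → f (L * Z) = diagPow κ L * f Z

variable {κ : Fin N → ℕ} {P : MvPolynomial (Fin N × Fin N) ℂ}

lemma LowerEquivariant.colPoly (hP : LowerEquivariant κ (matEval P)) (a : Fin N →₀ ℕ) :
    LowerEquivariant κ (colCoeff P a) := by
  intro L Z hL
  rw [← coeff_colPoly, ← coeff_colPoly, ← coeff_C_mul]
  congr 1
  refine MvPolynomial.funext fun s => ?_
  rw [map_mul, eval_C, eval_colPoly, eval_colPoly, Matrix.mul_assoc, hP L _ hL]

lemma LowerEquivariant.rowWeight (hP : LowerEquivariant κ (matEval P))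
    {m : Fin N × Fin N →₀ ℕ} (hm : m ∈ P.support) : m.mapDomain Prod.fst = toWeight κ := by
  refine mapDomain_eq_of_equivariant _ _ (fun d x => ?_) hm
  have := hP (diagonal d) (Matrix.of fun i j => x (i, j)) (blockTriangular_diagonal _)
  rw [matEval_of] at this
  simp only [toWeight_apply]
  rw [show ∏ t, d t ^ κ t = diagPow κ (diagonal d) by simp [diagPow], ← this, matEval]
  simp [entry]

lemma prod_entry_upper_eq_zero {R : Mat N} (hR : R.IsUpperTriangular) {m : Fin N × Fin N →₀ ℕ}
    (hm : ¬ ∀ p, m p ≠ 0 → p.1 ≤ p.2) : ∏ p, entry p R ^ m p = 0 := by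
  push Not at hm
  obtain ⟨p, hp, hlt⟩ := hm
  refine Finset.prod_eq_zero (Finset.mem_univ p) ?_
  rw [entry, hR hlt, zero_pow hp]

lemma LowerEquivariant.colCoeff_eq_zero (hP : LowerEquivariant κ (matEval P))
    {a : Fin N →₀ ℕ} (ha : ¬ LexLE a (toWeight κ)) (Z : Mat N) : colCoeff P a Z = 0 := by
  refine eq_zero_of_lower_mul_upper (colCoeff_mem_polyFun P a) (fun L R hL hR => ?_) Z
  rw [hP.colPoly a L R hL, colCoeff, Finset.sum_eq_zero, mul_zero]
  intro m hm
  rw [Finset.mem_filter] at hm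
  rw [prod_entry_upper_eq_zero hR, mul_zero]
  intro h
  refine ha ?_
  rw [← hm.2, ← hP.rowWeight hm.1]
  exact colWeight_lexLE h

lemma LowerEquivariant.colCoeff_eq (hκ : Antitone κ) (hP : LowerEquivariant κ (matEval P))
    (Z : Mat N) : colCoeff P (toWeight κ) Z = colCoeff P (toWeight κ) 1 * hwPoly κ Z := by
  refine hwPoly_unique hκ (colCoeff_mem_polyFun P _) (fun L R hL hR => ?_) Z
  rw [hP.colPoly _ L R hL]
  congr 1
  rw [colCoeff, colCoeff, Finset.mul_sum]
  refine Finset.sum_congr rfl fun m hm => ?_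
  rw [Finset.mem_filter] at hm
  by_cases h : ∀ p, m p ≠ 0 → p.1 ≤ p.2
  · have hd : ∀ {p}, m p ≠ 0 → p.1 = p.2 :=
      diagonal_of_colWeight_eq h (hm.2.trans (hP.rowWeight hm.1).symm)
    have h1 : ∀ A : Mat N, ∏ p, entry p A ^ m p = diagPow κ A := by
      intro A
      have h2 : ∀ i, κ i = (m.mapDomain Prod.fst) i := fun i => by
        rw [hP.rowWeight hm.1, toWeight_apply]
      simp only [diagPow, h2]
      rw [← prod_comp_pow Prod.fst (fun i => A i i) m]
      refine Finset.prod_congr rfl fun p _ => ?_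
      by_cases hp : m p = 0
      · rw [hp, pow_zero, pow_zero]
      · rw [entry, ← hd hp]
    rw [h1, h1, diagPow_one]
    ring
  · rw [prod_entry_upper_eq_zero hR h, prod_entry_upper_eq_zero (blockTriangular_one) h]
    simp

lemma colCoeff_of_homogeneous {a : Fin N → ℕ}
    (h : ∀ Z s, matEval P (Z * diagonal s) = (∏ i, s i ^ a i) * matEval P Z) (Z : Mat N) :
    colCoeff P (toWeight a) Z = matEval P Z := by
  have : UnitarySchur.colPoly P Z = monomial (toWeight a) (matEval P Z) := by
    refine MvPolynomial.funext fun s => ?_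
    rw [eval_colPoly, h, eval_monomial, Finsupp.prod_fintype _ _ (fun _ => pow_zero _), mul_comm]
    rfl
  rw [← coeff_colPoly, this, coeff_monomial, if_pos rfl]

end LowerEquivariant

end UnitarySchur

namespace UnitarySchur

open MvPolynomial

section CompleteSymmetric

variable {N : ℕ}

/-- The generating series of the complete homogeneous symmetric polynomials. -/
def hSeries (x : Fin N → ℂ) : PowerSeries ℂ := ∏ i, PowerSeries.mk fun n => x i ^ n

lemma derivative_geometric (a : ℂ) :
    PowerSeries.derivative ℂ (PowerSeries.mk fun n => a ^ n) =
      (PowerSeries.mk fun n => a ^ (n + 1)) * PowerSeries.mk fun n => a ^ n := by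
  ext n
  rw [PowerSeries.coeff_derivative, PowerSeries.coeff_mul]
  simp only [PowerSeries.coeff_mk]
  rw [Finset.sum_congr rfl fun p hp => show a ^ (p.1 + 1) * a ^ p.2 = a ^ (n + 1) by
    rw [← pow_add, ← Finset.HasAntidiagonal.mem_antidiagonal.1 hp]; congr 1; ring]
  simp [mul_comm]

lemma derivative_hSeries (x : Fin N → ℂ) :
    PowerSeries.derivative ℂ (hSeries x) =
      (PowerSeries.mk fun n => ∑ i, x i ^ (n + 1)) * hSeries x := by
  have h : ∀ s : Finset (Fin N),
      PowerSeries.derivative ℂ (∏ i ∈ s, PowerSeries.mk fun n => x i ^ n) =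
      (∑ i ∈ s, PowerSeries.mk fun n => x i ^ (n + 1)) *
        ∏ i ∈ s, PowerSeries.mk fun n => x i ^ n := by
    intro s
    induction s using Finset.induction_on with
    | empty => simp
    | insert i s hi ih =>
      rw [Finset.prod_insert hi, Finset.sum_insert hi, Derivation.leibniz, ih,
        derivative_geometric]
      simp only [smul_eq_mul]
      ring
  rw [hSeries, h]
  congr 1
  ext n
  simp

lemma trace_diagonal_pow (x : Fin N → ℂ) (m : ℕ) :
    ((diagonal x) ^ m).trace = ∑ i, x i ^ m := by
  simp [Matrix.diagonal_pow, Matrix.trace_diagonal]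

lemma hMat_diagonal (x : Fin N → ℂ) (k : ℕ) :
    hMat (diagonal x) k = PowerSeries.coeff k (hSeries x) := by
  induction k using Nat.strong_induction_on with
  | _ k ih =>
    rcases k with _ | k
    · rw [hMat, PowerSeries.coeff_zero_eq_constantCoeff_apply, hSeries, map_prod]
      simp
    · have h := congrArg (PowerSeries.coeff k) (derivative_hSeries x)
      rw [PowerSeries.coeff_derivative, PowerSeries.coeff_mul,
        Finset.Nat.sum_antidiagonal_eq_sum_range_succ_mk] at h
      rw [hMat, inv_mul_eq_iff_eq_mul₀ (Nat.cast_add_one_ne_zero k), mul_comm, h]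
      refine Finset.sum_congr rfl fun m hm => ?_
      rw [ih _ (by omega), trace_diagonal_pow, PowerSeries.coeff_mk]

lemma hMat_diagonal_eq_sum (x : Fin N → ℂ) (k : ℕ) :
    hMat (diagonal x) k = ∑ n ∈ Finset.finsuppAntidiag Finset.univ k, ∏ i, x i ^ n i := by
  rw [hMat_diagonal, hSeries, PowerSeries.coeff_prod]
  simp

lemma trace_mul_pow_comm (X Y : Mat N) (m : ℕ) :
    ((X * Y) ^ (m + 1)).trace = ((Y * X) ^ (m + 1)).trace := by
  have h : (X * Y) ^ (m + 1) = X * ((Y * X) ^ m * Y) := by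
    rw [pow_succ, ← mul_assoc, ← mul_assoc]
    congr 1
    exact mul_pow_mul X Y m
  rw [h, Matrix.trace_mul_comm, mul_assoc, ← pow_succ]

lemma hMat_mul_comm (X Y : Mat N) (k : ℕ) : hMat (X * Y) k = hMat (Y * X) k := by
  induction k using Nat.strong_induction_on with
  | _ k ih =>
    rcases k with _ | k
    · rw [hMat, hMat]
    · rw [hMat, hMat]
      congr 1
      refine Finset.sum_congr rfl fun m hm => ?_
      rw [ih _ (by omega), trace_mul_pow_comm]

lemma hMat_mem_polyFun (k : ℕ) : (fun X : Mat N => hMat X k) ∈ polyFun entry := by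
  have hpow : ∀ m p, (fun X : Mat N => entry p (X ^ m)) ∈ polyFun entry := by
    intro m
    induction m with
    | zero =>
      simp only [pow_zero]
      exact fun p => const_mem_polyFun _ _
    | succ m ih =>
      simp only [pow_succ]
      exact polyFun_entry_mul ih polyFun_entry_id
  have htr : ∀ m, (fun X : Mat N => (X ^ m).trace) ∈ polyFun entry := by
    intro m
    rw [show (fun X : Mat N => (X ^ m).trace) = ∑ i, fun X => entry (i, i) (X ^ m) by
      funext X
      simp [Matrix.trace, entry]]
    exact sum_mem fun i _ => hpow m _
  induction k using Nat.strong_induction_on with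
  | _ k ih =>
    rcases k with _ | k
    · simp only [hMat]
      exact const_mem_polyFun _ _
    · rw [show (fun X : Mat N => hMat X (k + 1)) = (fun _ => ((k : ℂ) + 1)⁻¹) *
          ∑ m ∈ Finset.range (k + 1), (fun X => (X ^ (m + 1)).trace) * fun X => hMat X (k - m) by
        funext X
        rw [hMat]
        simp]
      exact mul_mem (const_mem_polyFun _ _)
        (sum_mem fun m _ => mul_mem (htr _) (ih _ (by omega)))

end CompleteSymmetric

section CoefficientPolynomials

variable {X σ τ : Type*}

/-- Families of polynomials whose coefficients depend polynomially on the parameter. -/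
def coeffPoly (c : τ → X → ℂ) : Subring (X → MvPolynomial σ ℂ) where
  carrier := {F | ∀ n, (fun x => coeff n (F x)) ∈ polyFun c}
  mul_mem' := by
    intro F G hF hG n
    rw [show (fun x => coeff n ((F * G) x)) = ∑ p ∈ Finset.HasAntidiagonal.antidiagonal n,
        (fun x => coeff p.1 (F x)) * fun x => coeff p.2 (G x) by
      funext x
      simp [coeff_mul]]
    exact sum_mem fun p _ => mul_mem (hF _) (hG _)
  one_mem' := fun n => const_mem_polyFun c _
  add_mem' := by
    intro F G hF hG n
    simp only [Pi.add_apply, coeff_add]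
    exact add_mem (hF n) (hG n)
  zero_mem' := fun n => const_mem_polyFun c _
  neg_mem' := by
    intro F hF n
    simp only [Pi.neg_apply, coeff_neg]
    exact neg_mem (hF n)

lemma mem_coeffPoly_iff {c : τ → X → ℂ} {F : X → MvPolynomial σ ℂ} :
    F ∈ coeffPoly c ↔ ∀ n, (fun x => coeff n (F x)) ∈ polyFun c := Iff.rfl

lemma C_mem_coeffPoly {c : τ → X → ℂ} {f : X → ℂ} (hf : f ∈ polyFun c) :
    (fun x => MvPolynomial.C (σ := σ) (f x)) ∈ coeffPoly c := by
  refine mem_coeffPoly_iff.2 fun n => ?_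
  simp only [coeff_C]
  split_ifs with h
  · exact hf
  · exact const_mem_polyFun _ _

lemma const_mem_coeffPoly (c : τ → X → ℂ) (P : MvPolynomial σ ℂ) :
    (fun _ => P) ∈ coeffPoly c :=
  mem_coeffPoly_iff.2 fun _ => const_mem_polyFun _ _

end CoefficientPolynomials

section Substitution

variable {N : ℕ}

/-- The substitution `Z ↦ X Z`. -/
def linSubst (A : Mat N) :
    MvPolynomial (Fin N × Fin N) ℂ →ₐ[ℂ] MvPolynomial (Fin N × Fin N) ℂ :=
  aeval fun p => ∑ k, MvPolynomial.C (A p.1 k) * MvPolynomial.X (k, p.2)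

lemma matEval_linSubst (A Z : Mat N) (P : MvPolynomial (Fin N × Fin N) ℂ) :
    matEval (linSubst A P) Z = matEval P (A * Z) := by
  unfold matEval
  induction P using MvPolynomial.induction_on with
  | C a => simp [linSubst]
  | add p q hp hq => simp only [map_add, hp, hq]
  | mul_X p i h =>
    simp only [map_mul, h]
    congr 1
    simp [linSubst, entry, Matrix.mul_apply]

lemma linSubst_mul (A B : Mat N) (P : MvPolynomial (Fin N × Fin N) ℂ) :
    linSubst (A * B) P = linSubst B (linSubst A P) :=
  eq_of_matEval fun Z => by simp only [matEval_linSubst, Matrix.mul_assoc]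

/-- The matrix coefficients of the substitution `Z ↦ X Z` in the monomial basis. -/
def substCoeff (n m : Fin N × Fin N →₀ ℕ) (A : Mat N) : ℂ :=
  coeff n (linSubst A (monomial m 1))

lemma substCoeff_mem_polyFun (n m : Fin N × Fin N →₀ ℕ) : substCoeff n m ∈ polyFun entry := by
  have h : (fun A : Mat N => linSubst A (monomial m 1)) ∈ coeffPoly entry := by
    rw [show (fun A : Mat N => linSubst A (monomial m 1)) = ∏ p, (∑ k,
        (fun A => MvPolynomial.C (entry (p.1, k) A)) * fun _ => MvPolynomial.X (k, p.2)) ^ m p by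
      funext A
      rw [linSubst, aeval_monomial, Finsupp.prod_fintype _ _ (fun _ => pow_zero _)]
      simp [entry]]
    exact prod_mem fun p _ => pow_mem (sum_mem fun k _ => mul_mem
      (C_mem_coeffPoly (coord_mem_polyFun _ _)) (const_mem_coeffPoly _ _)) _
  exact mem_coeffPoly_iff.1 h n

lemma matEval_monomial (m : Fin N × Fin N →₀ ℕ) (a : ℂ) (Z : Mat N) :
    matEval (monomial m a) Z = a * ∏ p, entry p Z ^ m p := by
  rw [matEval, eval_monomial, Finsupp.prod_fintype _ _ (fun _ => pow_zero _)]

/-- Families of monomials in the columns of a matrix of variables. -/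
def colEquiv (N : ℕ) : (Fin N → (Fin N →₀ ℕ)) ≃ (Fin N × Fin N →₀ ℕ) where
  toFun f := Finsupp.equivFunOnFinite.symm fun q => f q.2 q.1
  invFun m := fun j => Finsupp.equivFunOnFinite.symm fun i => m (i, j)
  left_inv f := by ext; simp
  right_inv m := by ext; simp

/-- The monomials in a matrix of variables with degree `a j` in column `j`. -/
def colFinset (a : Fin N → ℕ) : Finset (Fin N × Fin N →₀ ℕ) :=
  (Fintype.piFinset fun j => Finset.finsuppAntidiag Finset.univ (a j)).map (colEquiv N).toEmbedding

lemma mem_colFinset {a : Fin N → ℕ} {m : Fin N × Fin N →₀ ℕ} :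
    m ∈ colFinset a ↔ m.mapDomain Prod.snd = toWeight a := by
  have h : ∀ j, (m.mapDomain Prod.snd) j = ∑ i, m (i, j) := by
    intro j
    rw [mapDomain_eq_sum, Fintype.sum_prod_type]
    simp [Finsupp.single_apply]
  rw [colFinset, Finset.mem_map_equiv, Fintype.mem_piFinset, DFunLike.ext_iff]
  refine forall_congr' fun j => ?_
  rw [h, Finset.mem_finsuppAntidiag]
  simp [colEquiv]

lemma linSubst_monomial {a : Fin N → ℕ} {m : Fin N × Fin N →₀ ℕ} (hm : m ∈ colFinset a)
    (A : Mat N) :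
    linSubst A (monomial m 1) = ∑ n ∈ colFinset a, monomial n (substCoeff n m A) := by
  conv_lhs => rw [(linSubst A (monomial m 1)).as_sum]
  refine Finset.sum_subset (fun n hn => ?_) fun n _ hn => ?_
  · refine mem_colFinset.2 (mapDomain_eq_of_equivariant _ _ (fun d x => ?_) hn)
    have h1 : eval (fun p : Fin N × Fin N => d p.2 * x p) (linSubst A (monomial m 1)) =
        matEval (linSubst A (monomial m 1)) (Matrix.of (fun i j => x (i, j)) * diagonal d) := by
      simp [matEval, entry, mul_comm]
    rw [h1, ← matEval_of, matEval_linSubst, matEval_linSubst, matEval_monomial, matEval_monomial,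
      ← Matrix.mul_assoc, ← mem_colFinset.1 hm, ← prod_comp_pow]
    simp only [entry, Matrix.mul_diagonal, mul_pow, Finset.prod_mul_distrib]
    ring
  · rw [MvPolynomial.notMem_support_iff.1 hn, monomial_zero]

lemma substCoeff_mul {a : Fin N → ℕ} {m : Fin N × Fin N →₀ ℕ} (hm : m ∈ colFinset a)
    (n : Fin N × Fin N →₀ ℕ) (A B : Mat N) :
    substCoeff n m (A * B) = ∑ k ∈ colFinset a, substCoeff k m A * substCoeff n k B := by
  rw [substCoeff, linSubst_mul, linSubst_monomial hm, map_sum, coeff_sum]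
  refine Finset.sum_congr rfl fun k _ => ?_
  rw [← mul_one (substCoeff k m A), ← C_mul_monomial, map_mul, linSubst, algHom_C, mul_one,
    algebraMap_eq, coeff_C_mul]
  rfl

lemma substCoeff_diagonal (m : Fin N × Fin N →₀ ℕ) (d : Fin N → ℂ) :
    substCoeff m m (diagonal d) = ∏ p, d p.1 ^ m p := by
  have : linSubst (diagonal d) (monomial m 1) = monomial m (∏ p, d p.1 ^ m p) := by
    refine eq_of_matEval fun Z => ?_
    rw [matEval_linSubst, matEval_monomial, matEval_monomial]
    simp only [entry, Matrix.diagonal_mul, mul_pow, Finset.prod_mul_distrib, one_mul]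
  rw [substCoeff, this, coeff_monomial, if_pos rfl]

lemma prod_hMat_diagonal (a : Fin N → ℕ) (d : Fin N → ℂ) :
    ∏ j, hMat (diagonal d) (a j) = ∑ m ∈ colFinset a, substCoeff m m (diagonal d) := by
  simp only [hMat_diagonal_eq_sum, Finset.prod_univ_sum, colFinset, Finset.sum_map]
  refine Finset.sum_congr rfl fun f _ => ?_
  simp only [Equiv.coe_toEmbedding, substCoeff_diagonal, Fintype.prod_prod_type]
  rw [Finset.prod_comm]
  rfl

lemma prod_hMat_eq (a : Fin N → ℕ) (A : Mat N) :
    ∏ j, hMat A (a j) = ∑ m ∈ colFinset a, substCoeff m m A := by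
  have hl : (∏ j, fun A : Mat N => hMat A (a j)) ∈ polyFun entry :=
    prod_mem fun j _ => hMat_mem_polyFun _
  have hr : (∑ m ∈ colFinset a, substCoeff m m) ∈ polyFun (entry (N := N)) :=
    sum_mem fun m _ => substCoeff_mem_polyFun _ _
  have h := eq_zero_of_conj_diagonal (sub_mem hl hr) Set.infinite_univ (fun V x _ => ?_) A
  · simpa [sub_eq_zero] using h
  · have e : star (V : Mat N) * ((V : Mat N) * diagonal x) = diagonal x := by
      rw [← Matrix.mul_assoc, star_mul_coe_self, one_mul]
    simp only [Pi.sub_apply, Finset.prod_apply, Finset.sum_apply]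
    rw [sub_eq_zero]
    simp only [hMat_mul_comm _ (star (V : Mat N)), e]
    rw [prod_hMat_diagonal]
    have hcomm : ∀ A B : Mat N, ∑ m ∈ colFinset a, substCoeff m m (A * B) =
        ∑ m ∈ colFinset a, substCoeff m m (B * A) := by
      intro A B
      rw [Finset.sum_congr rfl fun m hm => substCoeff_mul hm m A B,
        Finset.sum_congr rfl fun m hm => substCoeff_mul hm m B A, Finset.sum_comm]
      simp only [mul_comm]
    rw [hcomm, e]

end Substitution

end UnitarySchur

namespace UnitarySchur

open MvPolynomial

section Pairing

variable {N : ℕ}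

/-- The pairing of a function on matrices with a highest weight polynomial. -/
def pairing (ν : Measure (UN N)) (κ : Fin N → ℕ) (f : Mat N → ℂ) : ℂ :=
  ∫ U : UN N, f (U : Mat N) * hwPoly κ (star (U : Mat N)) ∂ν

lemma integrable_pairing (ν : Measure (UN N)) [IsFiniteMeasure ν] (κ : Fin N → ℕ) {f : Mat N → ℂ}
    (hf : f ∈ polyFun entry) :
    Integrable (fun U : UN N => f (U : Mat N) * hwPoly κ (star (U : Mat N))) ν :=
  integrable_of_continuous ν (((matPoly_continuous hf).comp continuous_coe_unitary).mul
    ((matPoly_continuous (hwPoly_mem_polyFun κ)).comp continuous_star_unitary))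

lemma pairing_sum (ν : Measure (UN N)) [IsFiniteMeasure ν] (κ : Fin N → ℕ) {ι : Type*}
    (s : Finset ι) (c : ι → ℂ) {f : ι → Mat N → ℂ} (hf : ∀ i ∈ s, f i ∈ polyFun entry) :
    pairing ν κ (fun X => ∑ i ∈ s, c i * f i X) = ∑ i ∈ s, c i * pairing ν κ (f i) := by
  simp only [pairing, Finset.sum_mul, mul_assoc]
  rw [integral_finsetSum]
  · simp only [integral_const_mul]
  · exact fun i hi => (integrable_pairing ν κ (hf i hi)).const_mul _

lemma pairing_sub (ν : Measure (UN N)) [IsFiniteMeasure ν] (κ : Fin N → ℕ) (c : ℂ)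
    {f g : Mat N → ℂ} (hf : f ∈ polyFun entry) (hg : g ∈ polyFun entry) :
    pairing ν κ (fun X => f X - c * g X) = pairing ν κ f - c * pairing ν κ g := by
  simp only [pairing, sub_mul, mul_assoc]
  rw [integral_sub (integrable_pairing ν κ hf) ((integrable_pairing ν κ hg).const_mul _),
    integral_const_mul]

lemma pairing_hwPoly (ν : Measure (UN N)) (κ : Fin N → ℕ) :
    pairing ν κ (hwPoly κ) = hwNorm ν κ := rfl

/-- The polynomial `Z ↦ ∫ m(U Z) Δ_κ(U†) dU` attached to a monomial `m`. -/
def pairingPoly (ν : Measure (UN N)) (κ a : Fin N → ℕ) (m : Fin N × Fin N →₀ ℕ) :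
    MvPolynomial (Fin N × Fin N) ℂ :=
  ∑ n ∈ colFinset a, monomial n (pairing ν κ (substCoeff n m))

variable {a κ : Fin N → ℕ} {m : Fin N × Fin N →₀ ℕ}

lemma coeff_pairingPoly (ν : Measure (UN N)) (hm : m ∈ colFinset a) :
    coeff m (pairingPoly ν κ a m) = pairing ν κ (substCoeff m m) := by
  simp only [pairingPoly, coeff_sum, coeff_monomial]
  rw [Finset.sum_ite_eq', if_pos hm]

lemma matEval_pairingPoly (ν : Measure (UN N)) [IsFiniteMeasure ν] (hm : m ∈ colFinset a)
    (Z : Mat N) :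
    matEval (pairingPoly ν κ a m) Z =
      pairing ν κ fun X => matEval (monomial m 1) (X * Z) := by
  have h : ∀ X, matEval (monomial m 1) (X * Z) =
      ∑ n ∈ colFinset a, (∏ p, entry p Z ^ n p) * substCoeff n m X := by
    intro X
    rw [← matEval_linSubst, linSubst_monomial hm, matEval, map_sum]
    refine Finset.sum_congr rfl fun n _ => ?_
    rw [← matEval, matEval_monomial, mul_comm]
  simp only [h]
  rw [pairing_sum ν κ _ _ fun n _ => substCoeff_mem_polyFun n m, pairingPoly, matEval, map_sum]
  refine Finset.sum_congr rfl fun n _ => ?_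
  rw [← matEval, matEval_monomial, mul_comm]

lemma pairingPoly_homogeneous (ν : Measure (UN N)) [IsFiniteMeasure ν] (hm : m ∈ colFinset a) (Z : Mat N) (s : Fin N → ℂ) :
    matEval (pairingPoly ν κ a m) (Z * diagonal s) =
      (∏ i, s i ^ a i) * matEval (pairingPoly ν κ a m) Z := by
  rw [matEval_pairingPoly ν hm, matEval_pairingPoly ν hm, pairing, pairing, ← integral_const_mul]
  refine integral_congr_ae (Filter.Eventually.of_forall fun U => ?_)
  have h : ∏ i, s i ^ a i = ∏ p : Fin N × Fin N, s p.2 ^ m p := by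
    rw [prod_comp_pow, mem_colFinset.1 hm]
    rfl
  simp only [matEval_monomial, ← Matrix.mul_assoc, h]
  simp only [entry, Matrix.mul_diagonal, mul_pow, Finset.prod_mul_distrib]
  ring

lemma pairing_prod_hMat_eq_sum (ν : Measure (UN N)) [IsFiniteMeasure ν] :
    pairing ν κ (fun X => ∏ j, hMat X (a j)) =
      ∑ m ∈ colFinset a, pairing ν κ (substCoeff m m) := by
  have := pairing_sum ν κ (colFinset a) (fun _ => 1) (f := fun m => substCoeff m m)
    fun m _ => substCoeff_mem_polyFun m m
  simp only [one_mul] at this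
  simp only [prod_hMat_eq, this]

variable (ν : Measure (UN N)) [ν.IsHaarMeasure] [IsProbabilityMeasure ν]

lemma pairingPoly_lowerEquivariant (hκ : Antitone κ) (hm : m ∈ colFinset a) :
    LowerEquivariant κ (matEval (pairingPoly ν κ a m)) := by
  have h : ∀ Z, matEval (pairingPoly ν κ a m) Z = ∫ U : UN N,
      matEval (monomial m 1) (U : Mat N) * hwPoly κ (Z * star (U : Mat N)) ∂ν := by
    intro Z
    have := integral_move ν (matEval_mem_polyFun (monomial m 1)) (hwPoly_mem_polyFun κ) Z 1
    simp only [one_mul, mul_one] at this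
    rw [matEval_pairingPoly ν hm, pairing, this]
  intro L Z hL
  rw [h, h, ← integral_const_mul]
  refine integral_congr_ae (Filter.Eventually.of_forall fun U => ?_)
  simp only [Matrix.mul_assoc, hwPoly_lower_mul hκ hL]
  ring

lemma pairing_prod_hMat_eq_zero (hκ : Antitone κ) (h : ¬ LexLE (toWeight a) (toWeight κ)) :
    pairing ν κ (fun X => ∏ j, hMat X (a j)) = 0 := by
  rw [pairing_prod_hMat_eq_sum]
  refine Finset.sum_eq_zero fun m hm => ?_
  have h0 : pairingPoly ν κ a m = 0 := eq_of_matEval fun Z => by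
    rw [← colCoeff_of_homogeneous (pairingPoly_homogeneous ν hm),
      (pairingPoly_lowerEquivariant ν hκ hm).colCoeff_eq_zero h]
    simp [matEval]
  rw [← coeff_pairingPoly ν hm, h0, coeff_zero]

lemma pairing_prod_hMat_self (hκ : Antitone κ) :
    pairing ν κ (fun X => ∏ j, hMat X (κ j)) = hwNorm ν κ := by
  obtain ⟨D, hD⟩ := mem_polyFun_iff.1 (hwPoly_mem_polyFun κ)
  have hDs : D.support ⊆ colFinset κ := fun m hm => by
    refine mem_colFinset.2 (mapDomain_eq_of_equivariant _ _ (fun d x => ?_) hm)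
    have h1 : eval (fun p : Fin N × Fin N => d p.2 * x p) D =
        hwPoly κ (Matrix.of (fun i j => x (i, j)) * diagonal d) := by
      rw [hD]
      simp [entry, mul_comm]
    rw [h1, hwPoly_mul_upper hκ (blockTriangular_diagonal _), hD]
    simp [diagPow, entry]
  rw [pairing_prod_hMat_eq_sum, ← pairing_hwPoly]
  have hexp : hwPoly κ = fun X => ∑ m ∈ colFinset κ, coeff m D * matEval (monomial m 1) X := by
    funext X
    rw [hD, eval_eq']
    simp only [matEval_monomial, one_mul]
    exact Finset.sum_subset hDs fun m _ hm => by
      rw [MvPolynomial.notMem_support_iff.1 hm, zero_mul]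
  conv_rhs => rw [hexp]
  rw [pairing_sum ν κ _ _ fun m _ => matEval_mem_polyFun _]
  refine Finset.sum_congr rfl fun m hm => ?_
  have h1 : matEval (pairingPoly ν κ κ m) 1 = pairing ν κ (matEval (monomial m 1)) := by
    rw [matEval_pairingPoly ν hm]
    simp only [mul_one]
  have h2 : pairingPoly ν κ κ m = MvPolynomial.C (matEval (pairingPoly ν κ κ m) 1) * D :=
    eq_of_matEval fun Z => by
      rw [← colCoeff_of_homogeneous (pairingPoly_homogeneous ν hm),
        (pairingPoly_lowerEquivariant ν hκ hm).colCoeff_eq hκ,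
        colCoeff_of_homogeneous (pairingPoly_homogeneous ν hm), hD]
      simp only [matEval, map_mul, eval_C]
  rw [← coeff_pairingPoly ν hm, h2, coeff_C_mul, h1, mul_comm]

end Pairing

end UnitarySchur

namespace UnitarySchur

open MvPolynomial

section SchurPolynomials

variable {N : ℕ}

lemma hMatZ_natCast (X : Mat N) (k : ℕ) : hMatZ X k = hMat X k := by
  simp [hMatZ]

lemma hMatZ_of_neg (X : Mat N) {k : ℤ} (hk : k < 0) : hMatZ X k = 0 := if_pos hk

lemma schur_mul_comm (l : Fin N → ℕ) (X Y : Mat N) : schur l (X * Y) = schur l (Y * X) := by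
  simp only [schur, hMatZ, hMat_mul_comm X Y]

lemma schur_mem_polyFun (l : Fin N → ℕ) : schur l ∈ polyFun (entry (N := N)) := by
  refine polyFun_det fun i j => ?_
  simp only [Matrix.of_apply, hMatZ]
  split_ifs with h
  · exact const_mem_polyFun _ _
  · exact hMat_mem_polyFun _

lemma schur_zero (X : Mat N) : schur (fun _ => 0) X = 1 := by
  rw [schur, Matrix.det_of_isUpperTriangular]
  · simp [hMatZ, hMat]
  · intro i j hij
    have hij : j < i := hij
    refine hMatZ_of_neg X ?_
    have : (j : ℕ) < i := hij
    push_cast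
    omega

/-- The product of `1 - x_r t` over `r ≠ j`. -/
def omitFactor (x : Fin N → ℂ) (j : Fin N) : Polynomial ℂ :=
  ∏ r ∈ Finset.univ.erase j, (1 - Polynomial.C (x r) * Polynomial.X)

lemma coeff_omitFactor (x : Fin N → ℂ) (j : Fin N) {k : ℕ} (hk : N ≤ k) :
    (omitFactor x j).coeff k = 0 := by
  refine Polynomial.coeff_eq_zero_of_natDegree_lt ?_
  have h := Polynomial.natDegree_prod_le (Finset.univ.erase j)
    fun r => 1 - Polynomial.C (x r) * Polynomial.X
  have h2 : ∑ r ∈ Finset.univ.erase j,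
      (1 - Polynomial.C (x r) * Polynomial.X : Polynomial ℂ).natDegree ≤
      (Finset.univ.erase j).card • 1 := Finset.sum_le_card_nsmul _ _ _ fun r _ => by
    refine (Polynomial.natDegree_sub_le _ _).trans (max_le (by simp) ?_)
    exact (Polynomial.natDegree_C_mul_le _ _).trans Polynomial.natDegree_X_le
  rw [Finset.card_erase_of_mem (Finset.mem_univ j), Finset.card_univ, Fintype.card_fin] at h2
  have hN := j.pos
  have h3 := h.trans h2
  rw [smul_eq_mul, mul_one] at h3
  exact lt_of_le_of_lt h3 (by omega)

lemma geometric_mul (a : ℂ) :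
    (PowerSeries.mk fun n => a ^ n) * (1 - PowerSeries.C a * PowerSeries.X) = 1 := by
  ext n
  rw [mul_sub, mul_one, map_sub, mul_left_comm, PowerSeries.coeff_C_mul]
  rcases n with _ | n
  · simp
  · rw [PowerSeries.coeff_succ_mul_X]
    simp [PowerSeries.coeff_one, pow_succ']

lemma hSeries_mul_omitFactor (x : Fin N → ℂ) (j : Fin N) :
    hSeries x * (omitFactor x j : PowerSeries ℂ) = PowerSeries.mk fun n => x j ^ n := by
  have h : (omitFactor x j : PowerSeries ℂ) =
      ∏ r ∈ Finset.univ.erase j, (1 - PowerSeries.C (x r) * PowerSeries.X) := by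
    rw [omitFactor, ← Polynomial.coeToPowerSeries.ringHom_apply, map_prod]
    simp
  rw [hSeries, ← Finset.mul_prod_erase _ _ (Finset.mem_univ j), h, mul_assoc,
    ← Finset.prod_mul_distrib, Finset.prod_congr rfl fun r _ => geometric_mul (x r),
    Finset.prod_const_one, mul_one]

lemma sum_hMatZ_mul_omitFactor (x : Fin N → ℂ) (j : Fin N) (n : ℕ) :
    ∑ k ∈ Finset.range N, hMatZ (diagonal x) ((n : ℤ) - k) * (omitFactor x j).coeff k =
      x j ^ n := by
  have h := congrArg (PowerSeries.coeff n) (hSeries_mul_omitFactor x j)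
  rw [mul_comm, PowerSeries.coeff_mul, Finset.Nat.sum_antidiagonal_eq_sum_range_succ_mk,
    PowerSeries.coeff_mk] at h
  rw [← h]
  have h1 : ∑ k ∈ Finset.range N, hMatZ (diagonal x) ((n : ℤ) - k) * (omitFactor x j).coeff k =
      ∑ k ∈ Finset.range (N + n.succ),
        hMatZ (diagonal x) ((n : ℤ) - k) * (omitFactor x j).coeff k := by
    refine Finset.sum_subset (Finset.range_mono (by omega)) fun k _ hk => ?_
    rw [Finset.mem_range, not_lt] at hk
    rw [coeff_omitFactor x j hk, mul_zero]
  have h2 : ∑ k ∈ Finset.range n.succ,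
        hMatZ (diagonal x) ((n : ℤ) - k) * (omitFactor x j).coeff k =
      ∑ k ∈ Finset.range (N + n.succ),
        hMatZ (diagonal x) ((n : ℤ) - k) * (omitFactor x j).coeff k := by
    refine Finset.sum_subset (Finset.range_mono (by omega)) fun k _ hk => ?_
    rw [Finset.mem_range, not_lt] at hk
    rw [hMatZ_of_neg _ (by omega), zero_mul]
  rw [h1, ← h2]
  refine Finset.sum_congr rfl fun k hk => ?_
  rw [Finset.mem_range] at hk
  rw [← Nat.cast_sub (by omega), hMatZ_natCast, hMat_diagonal, Polynomial.coeff_coe, mul_comm]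

/-- The staircase partition. -/
def staircase (N : ℕ) (i : Fin N) : ℕ := N - 1 - i

/-- The alternant with exponents `α`. -/
def alternant (α : Fin N → ℕ) : MvPolynomial (Fin N) ℂ :=
  (Matrix.of fun i j : Fin N => (MvPolynomial.X j : MvPolynomial (Fin N) ℂ) ^ α i).det

lemma eval_alternant (α : Fin N → ℕ) (x : Fin N → ℂ) :
    eval x (alternant α) = (Matrix.of fun i j : Fin N => x j ^ α i).det := by
  rw [alternant, RingHom.map_det]
  congr 1
  ext i j
  simp

lemma jacobiTrudi_mul (μ : Fin N → ℕ) (x : Fin N → ℂ) :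
    (Matrix.of fun i j : Fin N => hMatZ (diagonal x) ((μ i : ℤ) - i + j)) *
        (Matrix.of fun j k : Fin N => (omitFactor x k).coeff (N - 1 - j)) =
      Matrix.of fun i k : Fin N => x k ^ (μ i + staircase N i) := by
  ext i k
  rw [Matrix.mul_apply, Matrix.of_apply, ← sum_hMatZ_mul_omitFactor, ← Fin.sum_univ_eq_sum_range
    fun m => hMatZ (diagonal x) (((μ i + staircase N i : ℕ) : ℤ) - m) * (omitFactor x k).coeff m,
    ← Equiv.sum_comp Fin.revPerm]
  refine Finset.sum_congr rfl fun j _ => ?_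
  have hi := i.isLt
  have hj := j.isLt
  simp only [Matrix.of_apply, Fin.revPerm_apply, Fin.val_rev, staircase]
  congr 2 <;> omega

lemma schur_mul_alternant (μ : Fin N → ℕ) (x : Fin N → ℂ) :
    schur μ (diagonal x) * eval x (alternant (staircase N)) =
      eval x (alternant fun i => μ i + staircase N i) := by
  have h0 := congrArg Matrix.det (jacobiTrudi_mul (fun _ => 0) x)
  have h1 := congrArg Matrix.det (jacobiTrudi_mul μ x)
  rw [Matrix.det_mul] at h0 h1
  have hs := schur_zero (diagonal x)
  rw [schur] at hs
  rw [hs, one_mul] at h0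
  rw [eval_alternant, eval_alternant, ← h1, h0]
  simp [schur]

lemma exists_lt_perm_apply {σ : Equiv.Perm (Fin N)} (h : σ ≠ 1) :
    ∃ i, (∀ j < i, σ j = j) ∧ i < σ i := by
  have hne : (Finset.univ.filter fun i => σ i ≠ i).Nonempty := by
    by_contra he
    rw [Finset.not_nonempty_iff_eq_empty, Finset.filter_eq_empty_iff] at he
    exact h (Equiv.ext fun i => not_not.1 (he (Finset.mem_univ i)))
  set i := (Finset.univ.filter fun i => σ i ≠ i).min' hne with hi
  have hmem := Finset.min'_mem _ hne
  rw [← hi, Finset.mem_filter] at hmem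
  have hlt : ∀ j < i, σ j = j := fun j hj => by
    by_contra hc
    exact absurd (Finset.min'_le _ j (Finset.mem_filter.2 ⟨Finset.mem_univ _, hc⟩)) (not_le.2 hj)
  refine ⟨i, hlt, lt_of_le_of_ne (not_lt.1 fun hc => ?_) (Ne.symm hmem.2)⟩
  exact hmem.2 (σ.injective (hlt _ hc))

lemma lexLT_iff {a b : Fin N →₀ ℕ} :
    (lexOrder N).toSyn a < (lexOrder N).toSyn b ↔ ∃ i, (∀ j < i, a j = b j) ∧ a i < b i := by
  rw [MonomialOrder.lex_lt_iff, Finsupp.Lex.lt_iff]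
  rfl

lemma perm_lexLT {α : Fin N → ℕ} (hα : StrictAnti α) {σ : Equiv.Perm (Fin N)} (h : σ ≠ 1) :
    (lexOrder N).toSyn (toWeight (α ∘ σ)) < (lexOrder N).toSyn (toWeight α) := by
  obtain ⟨i, hi, hlt⟩ := exists_lt_perm_apply h
  exact lexLT_iff.2 ⟨i, fun j hj => by simp [hi j hj], hα hlt⟩

lemma alternant_eq (α : Fin N → ℕ) :
    alternant α = ∑ σ : Equiv.Perm (Fin N),
      monomial (toWeight (α ∘ σ)) (((Equiv.Perm.sign σ : ℤ) : ℂ)) := by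
  rw [alternant, Matrix.det_apply']
  refine Finset.sum_congr rfl fun σ _ => ?_
  rw [monomial_eq, Finsupp.prod_fintype _ _ (fun _ => pow_zero _)]
  simp

lemma coeff_alternant {α : Fin N → ℕ} (hα : StrictAnti α) :
    coeff (toWeight α) (alternant α) = 1 := by
  rw [alternant_eq, coeff_sum, Finset.sum_eq_single 1]
  · simp
  · intro σ _ hσ
    rw [coeff_monomial, if_neg]
    intro h
    exact (perm_lexLT hα hσ).ne (by rw [h])
  · simp

lemma degree_alternant {α : Fin N → ℕ} (hα : StrictAnti α) :
    (lexOrder N).degree (alternant α) = toWeight α := by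
  refine (lexOrder N).toSyn.injective (le_antisymm ?_ ?_)
  · refine MonomialOrder.degree_le_iff.2 fun b hb => ?_
    rw [alternant_eq] at hb
    obtain ⟨σ, -, hσ⟩ := Finset.mem_biUnion.1 (support_sum hb)
    rw [Finset.mem_singleton.1 (support_monomial_subset hσ)]
    by_cases h : σ = 1
    · rw [h]
      rfl
    · exact (perm_lexLT hα h).le
  · exact MonomialOrder.le_degree (by
      rw [MvPolynomial.mem_support_iff, coeff_alternant hα]
      exact one_ne_zero)

lemma leadingCoeff_alternant {α : Fin N → ℕ} (hα : StrictAnti α) :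
    (lexOrder N).leadingCoeff (alternant α) = 1 := by
  rw [MonomialOrder.leadingCoeff, degree_alternant hα, coeff_alternant hα]

lemma staircase_strictAnti : StrictAnti (staircase N) := by
  intro i j hij
  have h : (i : ℕ) < j := hij
  have := j.isLt
  simp only [staircase]
  omega

lemma exists_schurPoly {μ : Fin N → ℕ} (hμ : Antitone μ) :
    ∃ P : MvPolynomial (Fin N) ℂ, (∀ x, schur μ (diagonal x) = eval x P) ∧
      (lexOrder N).degree P = toWeight μ ∧ coeff (toWeight μ) P = 1 := by
  obtain ⟨P, hP⟩ := mem_polyFun_iff.1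
    (polyFun_comp (g := fun x : Fin N → ℂ => diagonal x) (schur_mem_polyFun μ)
      polyFun_entry_diagonal)
  have hα := staircase_strictAnti (N := N)
  have hβ : StrictAnti fun i => μ i + staircase N i := fun i j hij =>
    add_lt_add_of_le_of_lt (hμ hij.le) (hα hij)
  have hmul : P * alternant (staircase N) = alternant fun i => μ i + staircase N i :=
    MvPolynomial.funext fun x => by rw [map_mul, ← schur_mul_alternant, hP]
  have ha : ∀ {γ : Fin N → ℕ}, StrictAnti γ → alternant γ ≠ 0 := fun hγ h => by
    have := coeff_alternant hγ
    rw [h, coeff_zero] at this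
    exact zero_ne_one this
  have hP0 : P ≠ 0 := fun h => ha hβ (by rw [← hmul, h, zero_mul])
  have hdeg : (lexOrder N).degree P = toWeight μ := by
    have h := congrArg (lexOrder N).degree hmul
    rw [MonomialOrder.degree_mul hP0 (ha hα), degree_alternant hα, degree_alternant hβ] at h
    refine add_right_cancel (h.trans ?_)
    ext i
    rfl
  refine ⟨P, hP, hdeg, ?_⟩
  have h := congrArg (lexOrder N).leadingCoeff hmul
  rw [MonomialOrder.leadingCoeff_mul, leadingCoeff_alternant hα, leadingCoeff_alternant hβ,
    mul_one, MonomialOrder.leadingCoeff, hdeg] at h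
  exact h

lemma pairing_schur (ν : Measure (UN N)) [ν.IsHaarMeasure] [IsProbabilityMeasure ν]
    {κ μ : Fin N → ℕ} (hκ : Antitone κ) (h : LexLE (toWeight κ) (toWeight μ)) :
    pairing ν κ (schur μ) = if κ = μ then hwNorm ν κ else 0 := by
  have hexp : schur μ = fun X : Mat N => ∑ σ : Equiv.Perm (Fin N),
      ((Equiv.Perm.sign σ : ℤ) : ℂ) * ∏ i, hMatZ X ((μ i : ℤ) - i + σ i) := by
    funext X
    rw [schur, ← Matrix.det_transpose, Matrix.det_apply']
    simp
  have hmem : ∀ σ : Equiv.Perm (Fin N),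
      (fun X : Mat N => ∏ i, hMatZ X ((μ i : ℤ) - i + σ i)) ∈ polyFun entry := fun σ => by
    rw [show (fun X : Mat N => ∏ i, hMatZ X ((μ i : ℤ) - i + σ i)) =
      ∏ i, fun X : Mat N => hMatZ X ((μ i : ℤ) - i + σ i) by funext X; simp]
    refine prod_mem fun i _ => ?_
    simp only [hMatZ]
    split_ifs with h
    · exact const_mem_polyFun _ _
    · exact hMat_mem_polyFun _
  rw [hexp, pairing_sum ν κ _ _ fun σ _ => hmem σ, Finset.sum_eq_single 1]
  · simp only [Equiv.Perm.sign_one, Units.val_one, Int.cast_one, one_mul, Equiv.Perm.one_apply,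
      sub_add_cancel, hMatZ_natCast]
    split_ifs with hκμ
    · rw [← hκμ, pairing_prod_hMat_self ν hκ]
    · exact pairing_prod_hMat_eq_zero ν hκ fun h' =>
        hκμ (toWeight_injective ((lexOrder N).toSyn.injective (le_antisymm h h')))
  · intro σ _ hσ
    refine mul_eq_zero_of_right _ ?_
    by_cases hneg : ∃ i, (μ i : ℤ) - i + σ i < 0
    · obtain ⟨i, hi⟩ := hneg
      have : ∀ X : Mat N, ∏ i, hMatZ X ((μ i : ℤ) - i + σ i) = 0 := fun X =>
        Finset.prod_eq_zero (Finset.mem_univ i) (hMatZ_of_neg X hi)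
      simp [pairing, this]
    · push Not at hneg
      have : ∀ (X : Mat N) i, hMatZ X ((μ i : ℤ) - i + σ i) =
          hMat X ((μ i : ℤ) - i + σ i).toNat := fun X i => by
        rw [hMatZ, if_neg (not_lt.2 (hneg i))]
      simp only [this]
      refine pairing_prod_hMat_eq_zero ν hκ (not_le.2 (h.trans_lt ?_))
      obtain ⟨i, hi, hlt⟩ := exists_lt_perm_apply hσ
      refine lexLT_iff.2 ⟨i, fun j hj => ?_, ?_⟩
      · simp [hi j hj]
      · have h1 : (i : ℕ) < σ i := hlt
        simp only [toWeight_apply]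
        omega
  · simp

end SchurPolynomials

end UnitarySchur

namespace UnitarySchur

open MvPolynomial

section ClassFunctions

variable {N : ℕ}

lemma eq_zero_of_diagonal {f : Mat N → ℂ} (hf : f ∈ polyFun entry)
    (hc : ∀ X Y, f (X * Y) = f (Y * X)) (h : ∀ x, f (diagonal x) = 0) (A : Mat N) : f A = 0 :=
  eq_zero_of_conj_diagonal hf Set.infinite_univ (fun V x _ => by
    rw [hc, ← Matrix.mul_assoc, star_mul_coe_self, one_mul, h]) A

lemma diagonal_comp_perm {f : Mat N → ℂ} (hc : ∀ X Y, f (X * Y) = f (Y * X))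
    (x : Fin N → ℂ) (σ : Equiv.Perm (Fin N)) : f (diagonal (x ∘ σ)) = f (diagonal x) := by
  have h1 : (1 : Mat N).submatrix σ id * (diagonal x).submatrix id σ = diagonal (x ∘ σ) := by
    have := Matrix.submatrix_mul_equiv (1 : Mat N) (diagonal x) σ (Equiv.refl _) σ
    rw [one_mul, Matrix.submatrix_diagonal_equiv] at this
    exact this
  have h2 : (diagonal x).submatrix id σ * (1 : Mat N).submatrix σ id = diagonal x := by
    rw [Matrix.submatrix_mul_equiv, mul_one, Matrix.submatrix_id_id]
  rw [← h1, hc, h2]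

lemma degree_antitone {f : Mat N → ℂ} (hc : ∀ X Y, f (X * Y) = f (Y * X))
    {P : MvPolynomial (Fin N) ℂ} (hP : ∀ x, f (diagonal x) = eval x P) (hP0 : P ≠ 0) :
    Antitone ⇑((lexOrder N).degree P) := by
  set d := (lexOrder N).degree P with hd
  have hsym : ∀ σ : Equiv.Perm (Fin N), (lexOrder N).toSyn (d.mapDomain σ) ≤ (lexOrder N).toSyn d := by
    intro σ
    have hr : rename σ P = P := MvPolynomial.funext fun x => by
      rw [eval_rename, ← hP, ← hP, diagonal_comp_perm hc]
    refine MonomialOrder.le_degree ?_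
    rw [MvPolynomial.mem_support_iff]
    conv_lhs => rw [← hr]
    rw [coeff_rename_mapDomain _ σ.injective]
    exact MvPolynomial.mem_support_iff.1 (MonomialOrder.degree_mem_support hP0)
  intro i j hij
  by_contra hlt
  rw [not_le] at hlt
  have hne : i < j := lt_of_le_of_ne hij fun h => by rw [h] at hlt; exact lt_irrefl _ hlt
  refine absurd (hsym (Equiv.swap i j)) (not_le.2 (lexLT_iff.2 ⟨i, fun k hk => ?_, ?_⟩))
  · have := Finsupp.mapDomain_apply (Equiv.swap i j).injective d k
    rw [Equiv.swap_apply_of_ne_of_ne hk.ne (hk.trans hne).ne] at this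
    exact this.symm
  · have := Finsupp.mapDomain_apply (Equiv.swap i j).injective d j
    rw [Equiv.swap_apply_right] at this
    rw [this]
    exact hlt

/-- A nonzero polynomial class function pairs nontrivially with some highest weight polynomial
whose weight does not exceed its degree. -/
lemma exists_pairing_ne_zero (ν : Measure (UN N)) [ν.IsHaarMeasure] [IsProbabilityMeasure ν]
    {f : Mat N → ℂ} (hf : f ∈ polyFun entry) (hc : ∀ X Y, f (X * Y) = f (Y * X))
    {P : MvPolynomial (Fin N) ℂ} (hP : ∀ x, f (diagonal x) = eval x P) (hP0 : P ≠ 0) :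
    ∃ κ : Fin N → ℕ, Antitone κ ∧ LexLE (toWeight κ) ((lexOrder N).degree P) ∧
      pairing ν κ f ≠ 0 := by
  induction hD : (lexOrder N).toSyn ((lexOrder N).degree P) using WellFoundedLT.induction
    generalizing f P with
  | ind D ih =>
  subst hD
  have hd := degree_antitone hc hP hP0
  obtain ⟨d, hdeg⟩ : ∃ d : Fin N → ℕ, (lexOrder N).degree P = toWeight d :=
    ⟨_, ((Finsupp.equivFunOnFinite.symm_apply_apply _).symm)⟩
  rw [hdeg] at hd ih ⊢
  have hd : Antitone d := hd
  by_cases h0 : pairing ν d f = 0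
  swap
  · exact ⟨d, hd, le_rfl, h0⟩
  obtain ⟨S, hS, hSdeg, hScoeff⟩ := exists_schurPoly hd
  set c := coeff (toWeight d) P with hcdef
  have hc0 : c ≠ 0 := by
    rw [hcdef, ← hdeg]
    exact MvPolynomial.mem_support_iff.1 (MonomialOrder.degree_mem_support hP0)
  have hs := schur_mem_polyFun (N := N) d
  have hg : (fun X => f X - c * schur d X) ∈ polyFun entry :=
    sub_mem hf (mul_mem (const_mem_polyFun _ c) hs)
  have hpair : pairing ν d (fun X => f X - c * schur d X) ≠ 0 := by
    rw [pairing_sub ν d c hf hs, h0, pairing_schur ν hd le_rfl, if_pos rfl, zero_sub, neg_ne_zero]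
    exact mul_ne_zero hc0 (hwNorm_ne_zero ν d)
  have hgc : ∀ X Y : Mat N, f (X * Y) - c * schur d (X * Y) = f (Y * X) - c * schur d (Y * X) :=
    fun X Y => by rw [hc, schur_mul_comm]
  have hQ : ∀ x, f (diagonal x) - c * schur d (diagonal x) = eval x (P - MvPolynomial.C c * S) :=
    fun x => by rw [hP, hS, map_sub, map_mul, eval_C]
  have hQ0 : P - MvPolynomial.C c * S ≠ 0 := by
    intro h
    refine hpair ?_
    have : ∀ X : Mat N, f X - c * schur d X = 0 :=
      eq_zero_of_diagonal hg hgc fun x => by rw [hQ, h, map_zero]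
    simp [pairing, this]
  have hlt : (lexOrder N).toSyn ((lexOrder N).degree (P - MvPolynomial.C c * S)) <
      (lexOrder N).toSyn (toWeight d) := by
    refine lt_of_le_of_ne (MonomialOrder.degree_le_iff.2 fun b hb => ?_) fun h => ?_
    · rcases Finset.mem_union.1 (support_sub _ _ _ hb) with hb | hb
      · rw [← hdeg]
        exact MonomialOrder.le_degree hb
      · rw [← hSdeg]
        refine MonomialOrder.le_degree (MvPolynomial.mem_support_iff.2 fun h => ?_)
        rw [MvPolynomial.mem_support_iff, coeff_C_mul, h, mul_zero] at hb
        exact hb rfl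
    · have h1 := MonomialOrder.degree_mem_support (m := lexOrder N) hQ0
      rw [(lexOrder N).toSyn.injective h, MvPolynomial.mem_support_iff, coeff_sub, coeff_C_mul,
        hScoeff, mul_one, sub_self] at h1
      exact h1 rfl
  obtain ⟨κ, hκ, hle, hne⟩ := ih _ hlt hg hgc hQ hQ0 rfl
  have hle' : (lexOrder N).toSyn (toWeight κ) < (lexOrder N).toSyn (toWeight d) :=
    lt_of_le_of_lt hle hlt
  refine ⟨κ, hκ, hle'.le, ?_⟩
  rwa [pairing_sub ν κ c hf hs, pairing_schur ν hκ hle'.le,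
    if_neg fun h => hle'.ne (by rw [h]), mul_zero, sub_zero] at hne

end ClassFunctions

section ClassAverage

variable {N : ℕ} (ν : Measure (UN N)) [ν.IsHaarMeasure] [IsProbabilityMeasure ν]
  {μ : Fin N → ℕ}

/-- The average of a highest weight polynomial over a unitary conjugacy class. -/
def classAverage (ν : Measure (UN N)) (μ : Fin N → ℕ) (X : Mat N) : ℂ :=
  ∫ U : UN N, hwPoly μ ((U : Mat N) * X * star (U : Mat N)) ∂ν

lemma classAverage_mem_polyFun (ν : Measure (UN N)) [IsFiniteMeasure ν] (μ : Fin N → ℕ) :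
    classAverage ν μ ∈ polyFun entry := by
  have := integral_left_right_mem_polyFun ν (hwPoly_mem_polyFun μ) continuous_coe_unitary
    continuous_star_unitary (g := fun _ => 1) continuous_const
  simp only [mul_one] at this
  exact this

lemma classAverage_one (ν : Measure (UN N)) [IsProbabilityMeasure ν] (μ : Fin N → ℕ) :
    classAverage ν μ 1 = 1 := by
  simp only [classAverage, mul_one, coe_mul_star_self, hwPoly_one, integral_const]
  simp

lemma classAverage_mul_comm (μ : Fin N → ℕ) (X Y : Mat N) :
    classAverage ν μ (X * Y) = classAverage ν μ (Y * X) := by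
  have hF := classAverage_mem_polyFun ν μ
  refine eq_of_unitary (f := fun Y => classAverage ν μ (X * Y))
    (g := fun Y => classAverage ν μ (Y * X))
    (polyFun_comp hF (polyFun_entry_mul (polyFun_entry_const _ _) polyFun_entry_id))
    (polyFun_comp hF (polyFun_entry_mul polyFun_entry_id (polyFun_entry_const _ _)))
    (fun V => ?_) Y
  simp only [classAverage]
  rw [← integral_mul_right_unitary ν
    (fun U => hwPoly μ ((U : Mat N) * (X * (V : Mat N)) * star (U : Mat N))) V]
  refine integral_congr_ae (Filter.Eventually.of_forall fun U => ?_)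
  have h : ((U * V : UN N) : Mat N) * (X * (V : Mat N)) * star ((U * V : UN N) : Mat N) =
      (U : Mat N) * ((V : Mat N) * X) * star (U : Mat N) := by
    rw [Submonoid.coe_mul, star_mul]
    calc (U : Mat N) * V * (X * V) * (star (V : Mat N) * star (U : Mat N))
        = U * V * X * (V * star (V : Mat N)) * star (U : Mat N) := by
          simp only [Matrix.mul_assoc]
      _ = _ := by rw [coe_mul_star_self]; simp only [Matrix.mul_assoc, one_mul]
  simp only [h]

lemma exists_classAveragePoly (ν : Measure (UN N)) [IsFiniteMeasure ν] (hμ : Antitone μ) :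
    ∃ P : MvPolynomial (Fin N) ℂ, (∀ x, classAverage ν μ (diagonal x) = eval x P) ∧
      ∀ d ∈ P.support, LexLE d (toWeight μ) := by
  refine integral_poly_support ν
    (Φ := fun (U : UN N) x => hwPoly μ ((U : Mat N) * diagonal x * star (U : Mat N)))
    (paramPoly_comp (hwPoly_mem_polyFun μ) (paramPoly_entry_mul (paramPoly_entry_mul
      (paramPoly_entry_param _ continuous_coe_unitary)
      fun p => polyFun_mem_paramPoly (polyFun_entry_diagonal p))
      (paramPoly_entry_param _ continuous_star_unitary)))
    {d | LexLE d (toWeight μ)} fun U => ?_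
  obtain ⟨Q, hQ⟩ := mem_polyFun_iff.1 (polyFun_left_right (hwPoly_mem_polyFun μ) 1 (star (U : Mat N)))
  have hQ' : ∀ Z, matEval Q Z = hwPoly μ (Z * star (U : Mat N)) := fun Z => by
    have := hQ Z
    rw [one_mul] at this
    exact this.symm
  have hL : LowerEquivariant μ (matEval Q) := fun L Z hL => by
    rw [hQ', hQ', Matrix.mul_assoc, hwPoly_lower_mul hμ hL]
  refine ⟨colPoly Q U, fun x => by rw [eval_colPoly, hQ'], fun d hd => ?_⟩
  by_contra hle
  rw [MvPolynomial.mem_support_iff, coeff_colPoly] at hd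
  exact hd (hL.colCoeff_eq_zero hle _)

lemma pairing_classAverage {κ : Fin N → ℕ} (hμ : Antitone μ) (hκ : Antitone κ) :
    pairing ν κ (classAverage ν μ) = if μ = κ then hwNorm ν κ ^ 2 else 0 := by
  have hpμ := matPoly_continuous (hwPoly_mem_polyFun μ)
  have hpκ := matPoly_continuous (hwPoly_mem_polyFun κ)
  simp only [pairing, classAverage, ← integral_mul_const]
  rw [integral_swap_unitary ν]
  · have h : ∀ V : UN N, ∫ U : UN N, hwPoly μ ((V : Mat N) * U * star (V : Mat N)) *
        hwPoly κ (star (U : Mat N)) ∂ν = if μ = κ then hwNorm ν κ *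
          (hwPoly κ (V : Mat N) * hwPoly κ (star (V : Mat N))) else 0 := fun V => by
      have := hwPoly_orthogonality ν hμ hκ (V : Mat N) (star (V : Mat N)) 1 1
      simp only [one_mul, mul_one, mul_assoc] at this ⊢
      exact this
    simp only [h]
    split_ifs
    · rw [integral_const_mul, sq]
      rfl
    · simp
  · have hU : Continuous fun p : UN N × UN N => (p.1 : Mat N) :=
      continuous_coe_unitary.comp continuous_fst
    have hV : Continuous fun p : UN N × UN N => (p.2 : Mat N) :=
      continuous_coe_unitary.comp continuous_snd
    exact (hpμ.comp ((hV.mul hU).mul hV.star)).mul (hpκ.comp hU.star)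

/-- The class averages of the highest weight polynomials are the Schur polynomials, up to
normalization. -/
lemma classAverage_eq (hμ : Antitone μ) (X : Mat N) :
    classAverage ν μ X = hwNorm ν μ * schur μ X := by
  obtain ⟨P, hP, hPs⟩ := exists_classAveragePoly ν hμ
  obtain ⟨S, hS, hSdeg, hScoeff⟩ := exists_schurPoly hμ
  set k := coeff (toWeight μ) P with hk
  have hF := classAverage_mem_polyFun ν μ
  have hs := schur_mem_polyFun (N := N) μ
  have hg : (fun X => classAverage ν μ X - k * schur μ X) ∈ polyFun entry :=
    sub_mem hF (mul_mem (const_mem_polyFun _ k) hs)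
  have hgc : ∀ X Y : Mat N, classAverage ν μ (X * Y) - k * schur μ (X * Y) =
      classAverage ν μ (Y * X) - k * schur μ (Y * X) :=
    fun X Y => by rw [classAverage_mul_comm, schur_mul_comm]
  have hQ : ∀ x, classAverage ν μ (diagonal x) - k * schur μ (diagonal x) =
      eval x (P - MvPolynomial.C k * S) :=
    fun x => by rw [hP, hS, map_sub, map_mul, eval_C]
  have hQ0 : P - MvPolynomial.C k * S = 0 := by
    by_contra hQ0
    obtain ⟨κ, hκ, hle, hne⟩ := exists_pairing_ne_zero ν hg hgc hQ hQ0
    have hmem := MonomialOrder.degree_mem_support (m := lexOrder N) hQ0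
    set b := (lexOrder N).degree (P - MvPolynomial.C k * S) with hb
    have hbμ : (lexOrder N).toSyn b < (lexOrder N).toSyn (toWeight μ) := by
      refine lt_of_le_of_ne ?_ fun h => ?_
      · rcases Finset.mem_union.1 (support_sub _ _ _ hmem) with hm | hm
        · exact hPs _ hm
        · rw [← hSdeg]
          refine MonomialOrder.le_degree (MvPolynomial.mem_support_iff.2 fun h => ?_)
          rw [MvPolynomial.mem_support_iff, coeff_C_mul, h, mul_zero] at hm
          exact hm rfl
      · rw [(lexOrder N).toSyn.injective h, MvPolynomial.mem_support_iff, coeff_sub, coeff_C_mul,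
          hScoeff, mul_one, sub_self] at hmem
        exact hmem rfl
    have hlt : (lexOrder N).toSyn (toWeight κ) < (lexOrder N).toSyn (toWeight μ) :=
      lt_of_le_of_lt hle hbμ
    have hκμ : κ ≠ μ := fun h => hlt.ne (by rw [h])
    rw [pairing_sub ν κ k hF hs, pairing_classAverage ν hμ hκ, pairing_schur ν hκ hlt.le,
      if_neg hκμ.symm, if_neg hκμ] at hne
    simp at hne
  have hzero : ∀ X : Mat N, classAverage ν μ X - k * schur μ X = 0 :=
    eq_zero_of_diagonal hg hgc fun x => by rw [hQ, hQ0, map_zero]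
  have hpair := pairing_sub ν μ k hF hs
  rw [pairing_classAverage ν hμ hμ, pairing_schur ν hμ le_rfl, if_pos rfl, if_pos rfl] at hpair
  have hk2 : hwNorm ν μ ^ 2 - k * hwNorm ν μ = 0 := by
    rw [← hpair]
    simp [pairing, hzero]
  have hk3 : hwNorm ν μ = k := by
    refine mul_right_cancel₀ (hwNorm_ne_zero ν μ) ?_
    rw [← sq]
    exact sub_eq_zero.1 hk2
  rw [hk3]
  exact sub_eq_zero.1 (hzero X)

end ClassAverage

end UnitarySchur

namespace UnitarySchur

section Orthogonality

variable {N : ℕ}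

lemma schur_add_const (ν : Measure (UN N)) [ν.IsHaarMeasure] [IsProbabilityMeasure ν]
    {μ : Fin N → ℕ} (hμ : Antitone μ) (q : ℕ) (X : Mat N) :
    schur (fun i => μ i + q) X = X.det ^ q * schur μ X := by
  have hμq : Antitone fun i => μ i + q := fun i j h => Nat.add_le_add_right (hμ h) q
  refine mul_left_cancel₀ (hwNorm_ne_zero ν μ) ?_
  rw [← hwNorm_add_const ν hμ q, ← classAverage_eq ν hμq, hwNorm_add_const ν hμ q,
    mul_left_comm, ← classAverage_eq ν hμ, classAverage, classAverage, ← integral_const_mul]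
  refine integral_congr_ae (Filter.Eventually.of_forall fun U => ?_)
  have h : ((U : Mat N) * X * star (U : Mat N)).det = X.det := by
    rw [Matrix.det_mul_right_comm, coe_mul_star_self, one_mul]
  simp only [hwPoly_add_const hμ, h]

variable (ν : Measure (UN N)) [ν.IsHaarMeasure] [IsProbabilityMeasure ν]

lemma hwNorm_mul_schur_one {μ : Fin N → ℕ} (hμ : Antitone μ) :
    hwNorm ν μ * schur μ (1 : Mat N) = 1 := by
  rw [← classAverage_eq ν hμ, classAverage_one]

lemma integral_hwPoly_mul_schur {l m : Fin N → ℕ} (hl : Antitone l) (hm : Antitone m)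
    (V C B : Mat N) :
    ∫ U : UN N, hwPoly l (V * (U : Mat N) * C) * schur m (star (U : Mat N) * B) ∂ν =
      if l = m then hwNorm ν m * hwPoly m (V * B * C) else 0 := by
  have hpl := matPoly_continuous (hwPoly_mem_polyFun l)
  have hpm := matPoly_continuous (hwPoly_mem_polyFun m)
  refine mul_left_cancel₀ (hwNorm_ne_zero ν m) ?_
  rw [← integral_const_mul]
  simp only [mul_left_comm (hwNorm ν m), ← classAverage_eq ν hm, classAverage,
    ← integral_const_mul]
  rw [integral_swap_unitary ν]
  · have h : ∀ W : UN N, ∫ U : UN N, hwPoly l (V * (U : Mat N) * C) *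
        hwPoly m ((W : Mat N) * (star (U : Mat N) * B) * star (W : Mat N)) ∂ν =
        if l = m then hwNorm ν m * (hwPoly m (1 * (W : Mat N) * C) *
          hwPoly m (V * B * star (W : Mat N) * 1)) else 0 := fun W => by
      have := hwPoly_orthogonality ν hl hm V C (W : Mat N) (B * star (W : Mat N))
      simp only [one_mul, mul_one, Matrix.mul_assoc] at this ⊢
      rw [this]
      split_ifs
      · ring
      · rfl
    simp only [h]
    split_ifs with hlm
    · rw [integral_const_mul, hwPoly_orthogonality ν hm hm, if_pos rfl, one_mul, hwPoly_one]
      ring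
    · simp
  · have hU : Continuous fun p : UN N × UN N => (p.1 : Mat N) :=
      continuous_coe_unitary.comp continuous_fst
    have hW : Continuous fun p : UN N × UN N => (p.2 : Mat N) :=
      continuous_coe_unitary.comp continuous_snd
    exact (hpl.comp ((continuous_const.mul hU).mul continuous_const)).mul
      (hpm.comp ((hW.mul (hU.star.mul continuous_const)).mul hW.star))

/-- Orthogonality of Schur polynomials on the unitary group. -/
lemma integral_schur_mul_schur {l m : Fin N → ℕ} (hl : Antitone l) (hm : Antitone m)
    (A B : Mat N) :
    ∫ U : UN N, schur l ((U : Mat N) * A) * schur m (star (U : Mat N) * B) ∂ν =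
      if l = m then schur m (A * B) / schur m (1 : Mat N) else 0 := by
  have hpl := matPoly_continuous (hwPoly_mem_polyFun l)
  have hsm := matPoly_continuous (schur_mem_polyFun (N := N) m)
  refine mul_left_cancel₀ (hwNorm_ne_zero ν l) ?_
  rw [← integral_const_mul]
  simp only [← mul_assoc (hwNorm ν l), ← classAverage_eq ν hl, classAverage, ← integral_mul_const]
  rw [integral_swap_unitary ν]
  · have h : ∀ V : UN N, ∫ U : UN N, hwPoly l ((V : Mat N) * ((U : Mat N) * A) * star (V : Mat N)) *
        schur m (star (U : Mat N) * B) ∂ν = if l = m then hwNorm ν m *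
          hwPoly m ((V : Mat N) * (B * A) * star (V : Mat N)) else 0 := fun V => by
      have := integral_hwPoly_mul_schur ν hl hm (V : Mat N) (A * star (V : Mat N)) B
      simp only [Matrix.mul_assoc] at this ⊢
      exact this
    simp only [h]
    split_ifs with hlm
    · subst hlm
      have h1 := hwNorm_mul_schur_one ν hl
      rw [integral_const_mul, ← classAverage, classAverage_eq ν hl, schur_mul_comm,
        eq_div_of_mul_eq (right_ne_zero_of_mul_eq_one h1) h1]
      ring
    · simp
  · have hU : Continuous fun p : UN N × UN N => (p.1 : Mat N) :=
      continuous_coe_unitary.comp continuous_fst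
    have hV : Continuous fun p : UN N × UN N => (p.2 : Mat N) :=
      continuous_coe_unitary.comp continuous_snd
    exact (hpl.comp ((hV.mul (hU.mul continuous_const)).mul hV.star)).mul
      (hsm.comp (hU.star.mul continuous_const))

end Orthogonality

end UnitarySchur

/-- For `q ≥ 1` and invertible `A`:
`∫_{U(N)} s_λ(UA) s_μ(U†B) (det U)^q d_*U
= δ_{μ, λ+q^N} (det A)^{-q} s_μ(AB)/s_μ(I_N)`. -/
theorem statement9 {N : ℕ} (hN : 1 ≤ N)
    (A B : Matrix (Fin N) (Fin N) ℂ) (hA : IsUnit A.det)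
    (l m : Fin N → ℕ) (hl : Antitone l) (hm : Antitone m)
    (q : ℕ) (hq : 1 ≤ q)
    (μ : Measure (UN N)) [μ.IsHaarMeasure] [IsProbabilityMeasure μ] :
    (∫ U : UN N,
        schur l ((U : Matrix (Fin N) (Fin N) ℂ) * A) * schur m (star (U : Matrix (Fin N) (Fin N) ℂ) * B) *
          ((U : Matrix (Fin N) (Fin N) ℂ).det) ^ (q : ℤ) ∂μ) =
      if m = (fun i => l i + q) then
        A.det ^ (-(q : ℤ)) * (schur m (A * B) / schur m (1 : Matrix (Fin N) (Fin N) ℂ))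
      else 0 := by
  have hlq : Antitone fun i => l i + q := fun i j h => Nat.add_le_add_right (hl h) q
  have key : ∀ U : UN N,
      schur l ((U : Matrix (Fin N) (Fin N) ℂ) * A) *
          schur m (star (U : Matrix (Fin N) (Fin N) ℂ) * B) *
          ((U : Matrix (Fin N) (Fin N) ℂ).det) ^ (q : ℤ) =
        A.det ^ (-(q : ℤ)) * (schur (fun i => l i + q) ((U : Matrix (Fin N) (Fin N) ℂ) * A) *
          schur m (star (U : Matrix (Fin N) (Fin N) ℂ) * B)) := fun U => by
    have hA0 : A.det ≠ 0 := hA.ne_zero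
    rw [UnitarySchur.schur_add_const μ hl, Matrix.det_mul, mul_pow, _root_.zpow_neg, _root_.zpow_natCast,
      _root_.zpow_natCast]
    field_simp
  simp only [key]
  rw [integral_const_mul, UnitarySchur.integral_schur_mul_schur μ hlq hm]
  by_cases h : m = fun i => l i + q
  · rw [if_pos h, if_pos h.symm]
  · rw [if_neg h, if_neg (Ne.symm h), mul_zero]

end
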